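/- arXiv:1605.04230 — 9 statements merged into one kernel-verified Lean document; each statement's English description precedes it below -/
import Mathlib

section
/- For all real numbers a, b with a ≠ 0, the symmetric partial sums Σ_{k=−N}^{N} (b−2πk)/(a² + (b−2πk)²) converge as N → ∞, and lim_{N→∞} Σ_{k=−N}^{N} (b−2πk)/(a² + (b−2πk)²) = sin(b)/(2(cosh(a) − cos(b))). -/
open Real Filter

open scoped Topology

lemma sum_Icc_neg_natCast_eq_add_sum_range {M : Type*} [AddCommMonoid M] (f : ℤ → M) (N : ℕ) :
    ∑ k ∈ Finset.Icc (-(N : ℤ)) N, f k =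
      f 0 + ∑ n ∈ Finset.range N, (f (n + 1) + f (-(n + 1))) := by
  induction N with
  | zero => simp
  | succ N ih =>
    have h : Finset.Icc (-((N + 1 : ℕ) : ℤ)) (N + 1 : ℕ) =
        insert ((N : ℤ) + 1) (insert (-((N : ℤ) + 1)) (Finset.Icc (-(N : ℤ)) N)) := by
      ext k
      simp only [Finset.mem_insert, Finset.mem_Icc]
      lia
    rw [h, Finset.sum_insert, Finset.sum_insert, ih, Finset.sum_range_succ]
    · abel
    · simp
    · simp only [Finset.mem_insert, Finset.mem_Icc]
      lia

lemma tendsto_sum_Icc_one_div_sub_intCast {z : ℂ} (hz : z ∈ Complex.integerComplement) :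
    Tendsto (fun N : ℕ => ∑ k ∈ Finset.Icc (-(N : ℤ)) N, 1 / (z - k)) atTop
      (𝓝 (π * Complex.cot (π * z))) := by
  have h := (tendsto_logDeriv_euler_cot_sub hz).const_add (1 / z)
  rw [add_sub_cancel] at h
  refine h.congr fun N => ?_
  simp [sum_Icc_neg_natCast_eq_add_sum_range, cotTerm, -neg_add_rev]

lemma cosh_sub_cos_pos {a : ℝ} (ha : a ≠ 0) (b : ℝ) : 0 < Real.cosh a - Real.cos b := by
  linarith [Real.one_lt_cosh.2 ha, Real.cos_le_one b]

lemma cot_half_add_mul_I {a b : ℝ} (ha : a ≠ 0)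
    (hs : Complex.sin ((b + a * Complex.I) / 2) ≠ 0) :
    Complex.cot ((b + a * Complex.I) / 2) =
      (Real.sin b - Real.sinh a * Complex.I) / ((Real.cosh a - Real.cos b : ℝ) : ℂ) := by
  have hd : ((Real.cosh a - Real.cos b : ℝ) : ℂ) ≠ 0 :=
    Complex.ofReal_ne_zero.2 (cosh_sub_cos_pos ha b).ne'
  rw [Complex.cot, div_eq_div_iff hs hd]
  have hb : (b : ℂ) = 2 * (b / 2) := by ring
  have ha' : (a : ℂ) = 2 * (a / 2) := by ring
  push_cast
  rw [show ((b : ℂ) + a * Complex.I) / 2 = b / 2 + a / 2 * Complex.I by ring,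
    Complex.cos_add, Complex.sin_add, Complex.cos_mul_I, Complex.sin_mul_I]
  have e₁ : Complex.sin b = 2 * Complex.sin (b / 2) * Complex.cos (b / 2) := by
    rw [← Complex.sin_two_mul, ← hb]
  have e₂ : Complex.cos b = Complex.cos (b / 2) ^ 2 - Complex.sin (b / 2) ^ 2 := by
    rw [← Complex.cos_two_mul', ← hb]
  have e₃ : Complex.sinh a = 2 * Complex.sinh (a / 2) * Complex.cosh (a / 2) := by
    rw [← Complex.sinh_two_mul, ← ha']
  have e₄ : Complex.cosh a = Complex.cosh (a / 2) ^ 2 + Complex.sinh (a / 2) ^ 2 := by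
    rw [← Complex.cosh_two_mul, ← ha']
  rw [e₁, e₂, e₃, e₄]
  linear_combination
    (Complex.cos (b / 2) * Complex.cosh (a / 2) +
        Complex.I * Complex.sin (b / 2) * Complex.sinh (a / 2)) *
      (Complex.cosh_sq_sub_sinh_sq (a / 2 : ℂ) - Complex.sin_sq_add_cos_sq (b / 2 : ℂ)) +
    2 * Complex.sinh (a / 2) ^ 2 * Complex.cosh (a / 2) * Complex.cos (b / 2) * Complex.I_sq

/-- For all reals `a ≠ 0` and `b`, the symmetric partial sums
`Σ_{k=-N}^{N} (b-2πk)/(a² + (b-2πk)²)` converge as `N → ∞` to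
`sin b / (2(cosh a - cos b))`. -/
theorem stmt_9 (a b : ℝ) (ha : a ≠ 0) :
    Filter.Tendsto
      (fun N : ℕ => ∑ k ∈ Finset.Icc (-(N : ℤ)) (N : ℤ),
        (b - 2 * π * (k : ℝ)) / (a ^ 2 + (b - 2 * π * (k : ℝ)) ^ 2))
      Filter.atTop
      (nhds (Real.sin b / (2 * (Real.cosh a - Real.cos b)))) := by
  have hπ : (π : ℂ) ≠ 0 := Complex.ofReal_ne_zero.2 Real.pi_ne_zero
  set z : ℂ := (b + a * Complex.I) / ((2 * π : ℝ) : ℂ) with hz_def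
  have hz : z ∈ Complex.integerComplement := by
    rintro ⟨k, hk⟩
    have him := congrArg Complex.im hk
    rw [hz_def, Complex.div_ofReal_im] at him
    simp [eq_comm (a := (0 : ℝ)), ha, Real.pi_ne_zero] at him
  have hπz : π * z = (b + a * Complex.I) / 2 := by
    rw [hz_def]
    push_cast
    field_simp
  have hsin := sin_pi_mul_ne_zero hz
  have h := tendsto_sum_Icc_one_div_sub_intCast hz
  rw [hπz] at h hsin
  rw [cot_half_add_mul_I ha hsin] at h
  have hre := ((Complex.continuous_re.tendsto _).comp h).const_mul (1 / (2 * π))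
  have hlim : 1 / (2 * π) * ((π : ℂ) * ((Real.sin b - Real.sinh a * Complex.I) /
      ((Real.cosh a - Real.cos b : ℝ) : ℂ))).re =
      Real.sin b / (2 * (Real.cosh a - Real.cos b)) := by
    have hd := (cosh_sub_cos_pos ha b).ne'
    rw [Complex.re_ofReal_mul, Complex.div_ofReal_re, Complex.sub_re, Complex.re_ofReal_mul, Complex.I_re,
      Complex.ofReal_re, mul_zero, sub_zero]
    field_simp
  rw [hlim] at hre
  refine hre.congr fun N => ?_
  simp only [Function.comp_apply, Complex.re_sum, Finset.mul_sum]
  refine Finset.sum_congr rfl fun k _ => ?_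
  have hk : 1 / (z - k) = ((2 * π : ℝ) : ℂ) * (((b - 2 * π * k : ℝ) : ℂ) + a * Complex.I)⁻¹ := by
    rw [show z - k = (((b - 2 * π * k : ℝ) : ℂ) + a * Complex.I) / ((2 * π : ℝ) : ℂ) by
      rw [hz_def]; push_cast; field_simp; ring, one_div_div, div_eq_mul_inv]
  rw [hk, Complex.re_ofReal_mul, Complex.inv_re, Complex.normSq_add_mul_I]
  simp only [Complex.add_re, Complex.ofReal_re, Complex.re_ofReal_mul, Complex.I_re, mul_zero,
    add_zero]
  rw [add_comm (a ^ 2)]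
  field_simp
end

section
/- For all real numbers a, b with a ≠ 0, the series Σ_{k∈ℤ} a/(a² + (b−2πk)²) converges absolutely and Σ_{k∈ℤ} a/(a² + (b−2πk)²) = sinh(a)/(2(cosh(a) − cos(b))). -/
open Real

/-- The imaginary part of `cot ((b + a i) / 2)` for real `a ≠ 0` and `b`. -/
theorem im_cot_half_add_mul_I {a : ℝ} (ha : a ≠ 0) (b : ℝ) :
    (Complex.cot ((b + a * Complex.I) / 2)).im =
      -(Real.sinh a / (Real.cosh a - Real.cos b)) := by
  obtain ⟨x, rfl⟩ : ∃ x, b = 2 * x := ⟨b / 2, by ring⟩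
  obtain ⟨y, rfl⟩ : ∃ y, a = 2 * y := ⟨a / 2, by ring⟩
  have hy : Real.sinh y ≠ 0 := by
    rw [Ne, Real.sinh_eq_zero]
    rintro rfl
    simp at ha
  have hz : (((2 * x : ℝ) : ℂ) + ((2 * y : ℝ) : ℂ) * Complex.I) / 2 = x + y * Complex.I := by
    push_cast
    ring
  have hden : Real.sin x ^ 2 + Real.sinh y ^ 2 ≠ 0 := by positivity
  have h1 := Real.sin_sq_add_cos_sq x
  have h2 := Real.cosh_sq y
  have hnormSq : (Real.sin x * Real.cosh y) * (Real.sin x * Real.cosh y) +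
      (Real.cos x * Real.sinh y) * (Real.cos x * Real.sinh y) =
      Real.sin x ^ 2 + Real.sinh y ^ 2 := by
    linear_combination Real.sin x ^ 2 * h2 + Real.sinh y ^ 2 * h1
  have hcosh : Real.cosh (2 * y) - Real.cos (2 * x) =
      2 * (Real.sin x ^ 2 + Real.sinh y ^ 2) := by
    rw [Real.cosh_two_mul, Real.cos_two_mul]
    linear_combination h2 - 2 * h1
  rw [hz, Complex.cot, Complex.cos_add_mul_I, Complex.sin_add_mul_I, ← Complex.ofReal_cos,
    ← Complex.ofReal_sin, ← Complex.ofReal_cosh, ← Complex.ofReal_sinh, hcosh,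
    Real.sinh_two_mul, Complex.div_im]
  simp only [Complex.normSq_apply, Complex.add_re, Complex.add_im, Complex.sub_re, Complex.sub_im,
    Complex.mul_re, Complex.mul_im, Complex.ofReal_re, Complex.ofReal_im, Complex.I_re,
    Complex.I_im, mul_zero, zero_mul, mul_one, sub_zero, add_zero, zero_add, zero_sub]
  rw [hnormSq]
  field_simp
  linear_combination -h1

theorem summable_div_sq_add_sub_two_pi_mul_sq (a b : ℝ) (ha : a ≠ 0) :
    Summable (fun k : ℤ => a / (a ^ 2 + (b - 2 * π * (k : ℝ)) ^ 2)) := by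
  have h := (EisensteinSeries.linear_right_summable
    (-((b + a * Complex.I) / (2 * π))) 1 (le_refl 2)).norm.mul_left (a / (4 * π ^ 2))
  refine h.congr fun k => ?_
  have hz : ((1 : ℤ) : ℂ) * -((b + a * Complex.I) / (2 * π)) + k =
      ((k - b / (2 * π) : ℝ) : ℂ) + ((-(a / (2 * π)) : ℝ) : ℂ) * Complex.I := by
    push_cast
    ring
  have hpos : a ^ 2 + (b - 2 * π * (k : ℝ)) ^ 2 ≠ 0 := by positivity
  have hsq : (k - b / (2 * π)) ^ 2 + (-(a / (2 * π))) ^ 2 =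
      (a ^ 2 + (b - 2 * π * (k : ℝ)) ^ 2) / (4 * π ^ 2) := by
    field_simp
    ring
  rw [hz, norm_inv, norm_zpow, zpow_ofNat, Complex.sq_norm, Complex.normSq_add_mul_I, hsq]
  field_simp

/-- The terms are imaginary parts of simple fractions. -/
theorem div_sq_add_sub_two_pi_mul_sq_eq_im (a b : ℝ) (k : ℤ) :
    a / (a ^ 2 + (b - 2 * π * (k : ℝ)) ^ 2) =
      -(1 / (2 * π)) * (1 / ((b + a * Complex.I) / (2 * π) - k)).im := by
  have hz : (1 / ((b + a * Complex.I) / (2 * π) - k) : ℂ) =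
      ((2 * π : ℝ) : ℂ) * (((b - 2 * π * k : ℝ) : ℂ) + a * Complex.I)⁻¹ := by
    have hpi : (π : ℂ) ≠ 0 := by exact_mod_cast Real.pi_ne_zero
    have : (b + a * Complex.I) / (2 * π) - k =
        (((b - 2 * π * k : ℝ) : ℂ) + a * Complex.I) / ((2 * π : ℝ) : ℂ) := by
      push_cast
      field_simp
      ring
    rw [this, one_div_div, div_eq_mul_inv]
  rw [hz, Complex.im_ofReal_mul, Complex.inv_im, Complex.normSq_add_mul_I, add_comm (a ^ 2)]
  simp
  field_simp

/-- For all reals `a ≠ 0` and `b`, the series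
`Σ_{k∈ℤ} a/(a² + (b-2πk)²)` converges absolutely, with sum `sinh a / (2(cosh a - cos b))`. -/
theorem stmt_10 (a b : ℝ) (ha : a ≠ 0) :
    Summable (fun k : ℤ => |a / (a ^ 2 + (b - 2 * π * (k : ℝ)) ^ 2)|) ∧
    ∑' k : ℤ, a / (a ^ 2 + (b - 2 * π * (k : ℝ)) ^ 2) =
      Real.sinh a / (2 * (Real.cosh a - Real.cos b)) := by
  have hs := summable_div_sq_add_sub_two_pi_mul_sq a b ha
  refine ⟨hs.abs, ?_⟩
  set z : ℂ := (b + a * Complex.I) / (2 * π) with hz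
  have hpi : (π : ℂ) ≠ 0 := by exact_mod_cast Real.pi_ne_zero
  have hzim : z.im = a / (2 * π) := by
    have : z = ((b / (2 * π) : ℝ) : ℂ) + ((a / (2 * π) : ℝ) : ℂ) * Complex.I := by
      rw [hz]
      push_cast
      ring
    rw [this, Complex.add_im, Complex.ofReal_im, Complex.im_ofReal_mul, Complex.I_im, zero_add,
      mul_one]
  have hzmem : z ∈ Complex.integerComplement := by
    rintro ⟨n, hn⟩
    have := congrArg Complex.im hn
    rw [Complex.intCast_im, hzim] at this
    exact div_ne_zero ha (by positivity) this.symm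
  have hcot := (summable_cotTerm hzmem).hasSum
  rw [← cot_series_rep' hzmem] at hcot
  have him := (Complex.hasSum_im hcot).mul_left (-(1 / (2 * π)))
  have hnat := (hasSum_nat_add_iff' 1).mpr hs.hasSum.nat_add_neg
  have heq := hnat.unique (him.congr_fun fun n => ?_)
  · have h0 := div_sq_add_sub_two_pi_mul_sq_eq_im a b 0
    have hw : (π : ℂ) * z = (b + a * Complex.I) / 2 := by
      rw [hz]
      field_simp
    rw [← hz] at h0
    rw [hw, Complex.sub_im, Complex.im_ofReal_mul, im_cot_half_add_mul_I ha] at heq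
    simp only [Finset.sum_range_one, Nat.cast_zero, Int.cast_zero, neg_zero, sub_zero] at heq h0
    have : Real.sinh a / (2 * (Real.cosh a - Real.cos b)) =
        1 / (2 * π) * (π * (Real.sinh a / (Real.cosh a - Real.cos b))) := by
      field_simp
    rw [this]
    linear_combination heq + h0
  · rw [div_sq_add_sub_two_pi_mul_sq_eq_im, div_sq_add_sub_two_pi_mul_sq_eq_im, ← hz,
      ← mul_add, ← Complex.add_im]
    push_cast
    simp only [sub_neg_eq_add]
end

section
/- There is an absolute constant C > 0 (independent of L) such that for every L > 2 and all measurable sets A⁺ ⊆ {(x,y) ∈ S : |x−L| < 1} and A⁻ ⊆ {(x,y) ∈ S : |x+L| < 1}, one has ∫_{A⁺} ∫_{A⁻} |K(z,ξ)| dξ dz ≤ C · ∫_{A⁺ ∪ A⁻} ||x|−L| dz. -/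
open MeasureTheory Real

noncomputable section

instance : Fact (0 < 2 * π) := ⟨by positivity⟩

/-- The circle `𝕋 = ℝ/(2πℤ)` of circumference `2π`, carrying its Haar measure of mass `2π`. -/
abbrev Torus : Type := AddCircle (2 * π)

/-- The infinite strip `S = ℝ × 𝕋` with the product of Lebesgue and Haar measure. -/
abbrev Strip : Type := ℝ × Torus

/-- `cos`, well-defined on `𝕋 = ℝ/(2πℤ)`. -/
def cosT : Torus → ℝ := Real.cos_periodic.lift

/-- `sin`, well-defined on `𝕋 = ℝ/(2πℤ)`. -/
def sinT : Torus → ℝ := Real.sin_periodic.lift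

/-- The kernel `K(z,ξ) = log(cosh(x₁-x₂) - cos(y₁-y₂)) - |x₁-x₂| + log 2` on `S × S`. -/
def Kker (z ξ : Strip) : ℝ :=
  Real.log (Real.cosh (z.1 - ξ.1) - cosT (z.2 - ξ.2)) - |z.1 - ξ.1| + Real.log 2

lemma volume_strip_band (c d : ℝ) :
    volume {z : Strip | |z.1 - c| < d} = ENNReal.ofReal (2 * d) * ENNReal.ofReal (2 * π) := by
  have h : {z : Strip | |z.1 - c| < d} = Metric.ball c d ×ˢ (Set.univ : Set Torus) := by
    ext z
    simp [Real.dist_eq]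
  rw [h, Measure.volume_eq_prod, Measure.prod_prod, Real.volume_ball, AddCircle.measure_univ]

/-- Bathtub estimate: a set of given measure cannot concentrate too much around `{x = c}`. -/
lemma sq_volume_le_lintegral_abs_sub (c : ℝ) (A : Set Strip) (hA : volume A ≠ ⊤) :
    volume A * volume A ≤
      ENNReal.ofReal (16 * π) * ∫⁻ z in A, ENNReal.ofReal |z.1 - c| := by
  set I := ∫⁻ z in A, ENNReal.ofReal |z.1 - c|
  have hpi := Real.pi_pos
  rcases eq_or_ne I ⊤ with hItop | hItop
  · rw [hItop, ENNReal.mul_top (by simpa using hpi)]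
    exact le_top
  set a := (volume A).toReal
  have hva : volume A = ENNReal.ofReal a := (ENNReal.ofReal_toReal hA).symm
  have hvI : I = ENNReal.ofReal I.toReal := (ENNReal.ofReal_toReal hItop).symm
  have hI0 : 0 ≤ I.toReal := ENNReal.toReal_nonneg
  have ha0 : 0 ≤ a := ENNReal.toReal_nonneg
  rcases ha0.eq_or_lt with h0 | hpos
  · rw [hva, ← h0]
    simp
  set d := a / (8 * π) with hd
  have hd0 : 0 < d := by positivity
  have hmarkov : ENNReal.ofReal d *
      (volume.restrict A) {z : Strip | ENNReal.ofReal d ≤ ENNReal.ofReal |z.1 - c|} ≤ I :=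
    mul_meas_ge_le_lintegral (by fun_prop) _
  set m := (volume.restrict A) {z : Strip | ENNReal.ofReal d ≤ ENNReal.ofReal |z.1 - c|}
  have hsplit : volume A ≤ m + ENNReal.ofReal (2 * d) * ENNReal.ofReal (2 * π) := by
    rw [← volume_strip_band c d, ← Measure.restrict_apply_univ A]
    calc (volume.restrict A) Set.univ
        ≤ (volume.restrict A) ({z : Strip | ENNReal.ofReal d ≤ ENNReal.ofReal |z.1 - c|} ∪
            {z : Strip | |z.1 - c| < d}) := by
          refine measure_mono fun z _ => ?_
          rcases le_or_gt d |z.1 - c| with h | h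
          · exact Or.inl (ENNReal.ofReal_le_ofReal h)
          · exact Or.inr h
      _ ≤ m + (volume.restrict A) {z : Strip | |z.1 - c| < d} := measure_union_le _ _
      _ ≤ m + volume {z : Strip | |z.1 - c| < d} := by
          gcongr
          exact Measure.restrict_le_self
  have hkey : ENNReal.ofReal (d * a) ≤ ENNReal.ofReal (I.toReal + d * (2 * d * (2 * π))) := by
    rw [ENNReal.ofReal_add hI0 (by positivity), ENNReal.ofReal_mul hd0.le,
      ENNReal.ofReal_mul hd0.le, ENNReal.ofReal_mul (p := 2 * d) (by positivity), ← hvI, ← hva]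
    calc ENNReal.ofReal d * volume A
        ≤ ENNReal.ofReal d * (m + ENNReal.ofReal (2 * d) * ENNReal.ofReal (2 * π)) := by gcongr
      _ ≤ _ := by
          rw [mul_add]
          gcongr
  have hkey' : d * a ≤ I.toReal + d * (2 * d * (2 * π)) :=
    (ENNReal.ofReal_le_ofReal_iff (by positivity)).1 hkey
  have hda : a = 8 * π * d := by
    rw [hd]
    field_simp
  rw [hva, hvI, ← ENNReal.ofReal_mul ha0, ← ENNReal.ofReal_mul (by positivity)]
  apply ENNReal.ofReal_le_ofReal
  clear_value d
  have h1 : 4 * π * d * d ≤ I.toReal := by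
    rw [hda] at hkey'
    linarith
  have h2 := mul_le_mul_of_nonneg_left h1 (by positivity : 0 ≤ 16 * π)
  rw [hda]
  linarith

lemma abs_cosT_le_one (y : Torus) : |cosT y| ≤ 1 := by
  induction y using QuotientAddGroup.induction_on with
  | H y => exact Real.abs_cos_le_one y

lemma abs_log_le_three {u : ℝ} (h1 : 1 / 4 ≤ u) (h2 : u ≤ 4) : |Real.log u| ≤ 3 := by
  have hu : 0 < u := by linarith
  have h3 := Real.log_le_sub_one_of_pos hu
  have h4 := Real.one_sub_inv_le_log_of_pos hu
  have h5 : u⁻¹ ≤ 4 := by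
    rw [inv_le_comm₀ hu (by norm_num)]
    linarith
  exact abs_le.2 ⟨by linarith, by linarith⟩

lemma abs_Kker_le_three {z ξ : Strip} (h : 1 ≤ z.1 - ξ.1) : |Kker z ξ| ≤ 3 := by
  set t := z.1 - ξ.1 with ht
  obtain ⟨hc1, hc2⟩ := abs_le.1 (abs_cosT_le_one (z.2 - ξ.2))
  set k := cosT (z.2 - ξ.2) with hk
  have hE : 2 ≤ Real.exp t := by linarith [Real.add_one_le_exp t]
  set q := Real.exp (-t) with hq
  have hq0 : 0 < q := Real.exp_pos _
  have hEq : Real.exp t * q = 1 := by rw [hq, ← Real.exp_add]; simp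
  have hq2 : q ≤ 1 / 2 := by nlinarith
  have hu : (Real.cosh t - k) * q * 2 = 1 - 2 * k * q + q ^ 2 := by
    rw [Real.cosh_eq, ← hq]
    linear_combination hEq
  have hu1 : 1 / 4 ≤ (Real.cosh t - k) * q * 2 := by
    rw [hu]
    nlinarith
  have hu2 : (Real.cosh t - k) * q * 2 ≤ 4 := by
    rw [hu]
    nlinarith
  have hpos : 0 < Real.cosh t - k := by
    by_contra! hneg
    nlinarith
  have hK : Kker z ξ = Real.log ((Real.cosh t - k) * q * 2) := by
    rw [Real.log_mul (by positivity) (by norm_num), Real.log_mul hpos.ne' hq0.ne', hq,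
      Real.log_exp, Kker, ← ht, ← hk, abs_of_nonneg (by linarith : (0 : ℝ) ≤ t)]
    ring
  rw [hK]
  exact abs_log_le_three hu1 hu2

/-- There is an absolute constant `C > 0` (independent of `L`) such that for
every `L > 2` and all measurable `A⁺ ⊆ {|x-L| < 1}`, `A⁻ ⊆ {|x+L| < 1}` in `S`,
`∫_{A⁺}∫_{A⁻} |K(z,ξ)| dξ dz ≤ C·∫_{A⁺ ∪ A⁻} ||x|-L| dz`. -/
theorem stmt_12 :
    ∃ C > (0 : ℝ), ∀ L > (2 : ℝ), ∀ Ap Am : Set Strip,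
      MeasurableSet Ap → MeasurableSet Am →
      Ap ⊆ {z : Strip | |z.1 - L| < 1} → Am ⊆ {z : Strip | |z.1 + L| < 1} →
      ∫⁻ z in Ap, ∫⁻ ξ in Am, ENNReal.ofReal |Kker z ξ| ≤
        ENNReal.ofReal C * ∫⁻ z in Ap ∪ Am, ENNReal.ofReal |(|z.1| - L)| := by
  refine ⟨48 * π, by positivity, fun L hL Ap Am hAp hAm hp hm => ?_⟩
  set J := ∫⁻ z in Ap ∪ Am, ENNReal.ofReal |(|z.1| - L)|
  have hfin : ∀ (c : ℝ) (A : Set Strip), A ⊆ {z : Strip | |z.1 - c| < 1} → volume A ≠ ⊤ :=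
    fun c A h => ne_top_of_le_ne_top
      (by
        rw [volume_strip_band]
        exact ENNReal.mul_ne_top ENNReal.ofReal_ne_top ENNReal.ofReal_ne_top)
      (measure_mono h)
  have hm' : Am ⊆ {z : Strip | |z.1 - (-L)| < 1} := by simpa using hm
  have hp2 : volume Ap * volume Ap ≤ ENNReal.ofReal (16 * π) * J := by
    refine (sq_volume_le_lintegral_abs_sub L Ap (hfin L Ap hp)).trans ?_
    gcongr
    refine le_trans (setLIntegral_mono' hAp fun z hz => ?_)
      (lintegral_mono_set Set.subset_union_left)
    have h := abs_lt.1 (show |z.1 - L| < 1 from hp hz)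
    rw [abs_of_pos (by linarith : (0 : ℝ) < z.1)]
  have hm2 : volume Am * volume Am ≤ ENNReal.ofReal (16 * π) * J := by
    refine (sq_volume_le_lintegral_abs_sub (-L) Am (hfin (-L) Am hm')).trans ?_
    gcongr
    refine le_trans (setLIntegral_mono' hAm fun z hz => ?_)
      (lintegral_mono_set Set.subset_union_right)
    have h := abs_lt.1 (show |z.1 + L| < 1 from hm hz)
    rw [abs_of_neg (by linarith : z.1 < (0 : ℝ)), ← abs_neg (z.1 - -L),
      show -(z.1 - -L) = -z.1 - L by ring]
  have hprod : volume Ap * volume Am ≤ ENNReal.ofReal (16 * π) * J := by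
    rcases le_total (volume Ap) (volume Am) with h | h
    · exact le_trans (by gcongr) hm2
    · exact le_trans (by gcongr) hp2
  calc ∫⁻ z in Ap, ∫⁻ ξ in Am, ENNReal.ofReal |Kker z ξ|
      ≤ ∫⁻ _ in Ap, ∫⁻ _ in Am, ENNReal.ofReal 3 := by
        refine setLIntegral_mono' hAp fun z hz => setLIntegral_mono' hAm fun ξ hξ => ?_
        have h1 := abs_lt.1 (show |z.1 - L| < 1 from hp hz)
        have h2 := abs_lt.1 (show |ξ.1 + L| < 1 from hm hξ)
        exact ENNReal.ofReal_le_ofReal (abs_Kker_le_three (by linarith))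
    _ = ENNReal.ofReal 3 * (volume Ap * volume Am) := by
        rw [setLIntegral_const, setLIntegral_const]
        ring
    _ ≤ ENNReal.ofReal 3 * (ENNReal.ofReal (16 * π) * J) := by gcongr
    _ = ENNReal.ofReal (48 * π) * J := by
        rw [← mul_assoc, ← ENNReal.ofReal_mul (by norm_num)]
        ring_nf
end
end

section
/- There is an absolute constant C > 0 such that for every measurable set A ⊆ [−1,1] × 𝕋 one has ∫_A ∫_A |log d(z,ξ)| dz dξ ≤ C · ∫_A |x| dz, where d is the distance on S = ℝ × 𝕋 given by d(z,ξ) = √((x₁−x₂)² + d_𝕋(y₁,y₂)²) for z = (x₁,y₁), ξ = (x₂,y₂), and d_𝕋 is the quotient metric on 𝕋. -/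
open MeasureTheory Real

noncomputable section

/-- A one-dimensional bathtub inequality: a set of given length is at least as far from the origin,
on average, as a centred interval. -/
lemma volume_sq_le_lintegral_abs (S : Set ℝ) (hS : volume S ≠ ⊤) :
    volume S ^ 2 ≤ 8 * ∫⁻ x in S, ENNReal.ofReal |x| := by
  obtain ⟨m, hm⟩ : ∃ m, m = (volume S).toReal := ⟨_, rfl⟩
  have hm0 : 0 ≤ m := hm ▸ ENNReal.toReal_nonneg
  have hv : volume S = ENNReal.ofReal m := by rw [hm, ENNReal.ofReal_toReal hS]
  have hmeas : MeasurableSet {x : ℝ | ENNReal.ofReal (m / 4) ≤ ENNReal.ofReal |x|} :=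
    measurableSet_le measurable_const (by fun_prop)
  have markov := mul_meas_ge_le_lintegral (μ := volume.restrict S)
    (f := fun x : ℝ => ENNReal.ofReal |x|) (by fun_prop) (ENNReal.ofReal (m / 4))
  rw [Measure.restrict_apply hmeas] at markov
  have hcover : S ⊆ ({x : ℝ | ENNReal.ofReal (m / 4) ≤ ENNReal.ofReal |x|} ∩ S) ∪
      Set.Icc (-(m / 4)) (m / 4) := by
    intro x hx
    by_cases h : m / 4 ≤ |x|
    · exact Or.inl ⟨ENNReal.ofReal_le_ofReal h, hx⟩
    · exact Or.inr (abs_le.mp (not_le.mp h).le)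
  have hle := (measure_mono hcover).trans (measure_union_le (μ := volume) _ _)
  rw [Real.volume_Icc, hv] at hle
  have hhalf : ENNReal.ofReal (m / 2) ≤
      volume ({x : ℝ | ENNReal.ofReal (m / 4) ≤ ENNReal.ofReal |x|} ∩ S) := by
    have hsplit : ENNReal.ofReal m = ENNReal.ofReal (m / 2) + ENNReal.ofReal (m / 4 - -(m / 4)) := by
      rw [← ENNReal.ofReal_add (by linarith) (by linarith)]
      congr 1
      ring
    rw [hsplit] at hle
    exact (ENNReal.add_le_add_iff_right ENNReal.ofReal_ne_top).mp hle
  calc volume S ^ 2 = 8 * (ENNReal.ofReal (m / 4) * ENNReal.ofReal (m / 2)) := by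
        rw [hv, ← ENNReal.ofReal_pow hm0, ← ENNReal.ofReal_mul (by linarith),
          ← ENNReal.ofReal_ofNat 8, ← ENNReal.ofReal_mul (by norm_num)]
        congr 1
        ring
    _ ≤ _ := by
        gcongr
        exact (by gcongr : _ ≤ _).trans markov

/-- Tonelli's theorem on the strip, integrating over horizontal slices first. -/
lemma setLIntegral_strip (A : Set Strip) (hA : MeasurableSet A) (h : Strip → ENNReal)
    (hh : Measurable h) :
    ∫⁻ z in A, h z = ∫⁻ y : Torus, ∫⁻ x in {x : ℝ | (x, y) ∈ A}, h (x, y) := by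
  rw [← lintegral_indicator hA, Measure.volume_eq_prod,
    lintegral_prod_symm' _ (hh.indicator hA)]
  refine lintegral_congr fun y => ?_
  exact lintegral_indicator (measurable_prodMk_right hA) fun x => h (x, y)

/-- A kernel on the circle dominating `|log d(z,ξ)|` in terms of the angular difference only. -/
def logKernel (t : Torus) : ENNReal :=
  ENNReal.ofReal (6 + |Real.log ‖t‖|) + Set.indicator ({0} : Set Torus) (fun _ => ⊤) t

lemma measurable_logKernel : Measurable logKernel := by
  have hlog : Measurable fun t : Torus => Real.log ‖t‖ := Real.measurable_log.comp measurable_norm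
  exact (measurable_const.add hlog.abs).ennreal_ofReal.add
    (measurable_const.indicator (measurableSet_singleton 0))

lemma lintegral_logKernel_ne_top : ∫⁻ t, logKernel t ≠ ⊤ := by
  rw [← AddCircle.lintegral_preimage (2 * π) (-π)]
  have hint : IntegrableOn (fun a : ℝ => 6 + |Real.log a|) (Set.Ioc (-π) (-π + 2 * π)) :=
    (integrableOn_const measure_Ioc_lt_top.ne).add
      ((intervalIntegrable_iff_integrableOn_Ioc_of_le (by linarith [pi_pos])).mp
        intervalIntegral.intervalIntegrable_log').abs
  refine ne_of_lt (lt_of_eq_of_lt ?_ hint.lintegral_lt_top)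
  refine lintegral_congr_ae ?_
  filter_upwards [ae_restrict_mem measurableSet_Ioc,
    ae_restrict_of_ae (Measure.ae_ne volume (0 : ℝ))] with a ha ha0
  have hnorm : ‖(a : Torus)‖ = |a| := by
    rw [AddCircle.norm_coe_eq_abs_iff _ two_pi_pos.ne', abs_of_pos two_pi_pos, abs_le]
    constructor <;> linarith [ha.1, ha.2]
  have hne : (a : Torus) ≠ 0 := by
    rw [← norm_ne_zero_iff, hnorm]
    exact abs_ne_zero.mpr ha0
  simp [logKernel, hnorm, hne, Real.log_abs]

lemma abs_log_dist_le_logKernel (z ξ : Strip) (hz : z.1 ∈ Set.Icc (-1 : ℝ) 1)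
    (hξ : ξ.1 ∈ Set.Icc (-1 : ℝ) 1) :
    ENNReal.ofReal |Real.log (Real.sqrt ((z.1 - ξ.1) ^ 2 + ‖z.2 - ξ.2‖ ^ 2))| ≤
      logKernel (z.2 - ξ.2) := by
  by_cases h0 : z.2 - ξ.2 = 0
  · simp [logKernel, h0]
  refine le_add_right (ENNReal.ofReal_le_ofReal ?_)
  have htpos : 0 < ‖z.2 - ξ.2‖ := norm_pos_iff.mpr h0
  have htle : ‖z.2 - ξ.2‖ ≤ 4 := by
    have := AddCircle.norm_le_half_period (2 * π) (x := z.2 - ξ.2) (by positivity)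
    rw [abs_of_pos (by positivity)] at this
    linarith [pi_lt_four]
  set t := ‖z.2 - ξ.2‖
  set d := Real.sqrt ((z.1 - ξ.1) ^ 2 + t ^ 2)
  have hd : t ≤ d := Real.le_sqrt_of_sq_le (by nlinarith)
  have hd6 : d ≤ 6 := by
    refine Real.sqrt_le_iff.mpr ⟨by norm_num, ?_⟩
    nlinarith [hz.1, hz.2, hξ.1, hξ.2]
  have hlow := Real.log_le_log htpos hd
  have hup := Real.log_le_sub_one_of_pos (htpos.trans_le hd)
  rw [abs_le]
  constructor <;> linarith [neg_abs_le (Real.log t), abs_nonneg (Real.log t)]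

/-- Schur's test for an even convolution kernel, in the form of a bound on its quadratic form. -/
lemma lintegral_mul_lintegral_sub_le {G : Type*} [AddCommGroup G] [MeasurableSpace G]
    [MeasurableAdd₂ G] [MeasurableNeg G] (μ : Measure G) [SFinite μ] [μ.IsAddLeftInvariant]
    [μ.IsNegInvariant] (K f : G → ENNReal) (hK : Measurable K) (hf : Measurable f) :
    ∫⁻ y, f y * ∫⁻ y', f y' * K (y - y') ∂μ ∂μ ≤ 2 * (∫⁻ t, K t ∂μ) * ∫⁻ y, f y ^ 2 ∂μ := by
  have hKsub : Measurable fun p : G × G => K (p.1 - p.2) := by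
    simp_rw [sub_eq_add_neg]
    exact hK.comp (measurable_fst.add measurable_snd.neg)
  have hKm (y : G) : Measurable fun y' => K (y - y') := hKsub.comp measurable_prodMk_left
  have amgm (a b : ENNReal) : a * b ≤ a ^ 2 + b ^ 2 := by
    rcases le_total a b with h | h
    · exact (by rw [sq]; gcongr : a * b ≤ b ^ 2).trans le_add_self
    · exact (by rw [sq]; gcongr : a * b ≤ a ^ 2).trans le_self_add
  have hfst : ∫⁻ y, ∫⁻ y', f y ^ 2 * K (y - y') ∂μ ∂μ = (∫⁻ t, K t ∂μ) * ∫⁻ y, f y ^ 2 ∂μ := by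
    simp_rw [lintegral_const_mul _ (hKm _), lintegral_sub_left_eq_self (μ := μ) K]
    rw [lintegral_mul_const _ (hf.pow_const 2), mul_comm]
  have hsnd : ∫⁻ y, ∫⁻ y', f y' ^ 2 * K (y - y') ∂μ ∂μ =
      (∫⁻ t, K t ∂μ) * ∫⁻ y, f y ^ 2 ∂μ := by
    rw [lintegral_lintegral_swap
      ((((hf.comp measurable_snd).pow_const 2).mul hKsub).aemeasurable)]
    have hK' (y' : G) : Measurable fun y => K (y - y') := hKsub.comp measurable_prodMk_right
    simp_rw [lintegral_const_mul _ (hK' _), sub_eq_add_neg, lintegral_add_right_eq_self (μ := μ) K]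
    rw [lintegral_mul_const _ (hf.pow_const 2), mul_comm]
  calc ∫⁻ y, f y * ∫⁻ y', f y' * K (y - y') ∂μ ∂μ
      = ∫⁻ y, ∫⁻ y', f y * (f y' * K (y - y')) ∂μ ∂μ := 
        lintegral_congr fun y => (lintegral_const_mul _ (hf.mul (hKm y))).symm
    _ ≤ ∫⁻ y, ∫⁻ y', (f y ^ 2 * K (y - y') + f y' ^ 2 * K (y - y')) ∂μ ∂μ := by
        refine lintegral_mono fun y => lintegral_mono fun y' => ?_
        dsimp only
        rw [← mul_assoc, ← add_mul]
        gcongr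
        exact amgm _ _
    _ = 2 * (∫⁻ t, K t ∂μ) * ∫⁻ y, f y ^ 2 ∂μ := by
        simp_rw [lintegral_add_left ((hKm _).const_mul _)]
        rw [lintegral_add_left, hfst, hsnd]
        · ring
        · exact Measurable.lintegral_prod_right' (f := fun p : G × G => f p.1 ^ 2 * K (p.1 - p.2))
            (((hf.comp measurable_fst).pow_const 2).mul hKsub)

/-- There is an absolute constant `C > 0` such that for every measurable
`A ⊆ [-1,1] × 𝕋`, `∫_A ∫_A |log d(z,ξ)| dz dξ ≤ C·∫_A |x| dz`, where
`d(z,ξ) = √((x₁-x₂)² + d_𝕋(y₁,y₂)²)` and `d_𝕋` is the quotient metric on `𝕋`. -/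
theorem stmt_13 :
    ∃ C > (0 : ℝ), ∀ A : Set Strip, MeasurableSet A →
      A ⊆ Set.Icc (-1 : ℝ) 1 ×ˢ (Set.univ : Set Torus) →
      ∫⁻ z in A, ∫⁻ ξ in A,
          ENNReal.ofReal |Real.log (Real.sqrt ((z.1 - ξ.1) ^ 2 + ‖z.2 - ξ.2‖ ^ 2))| ≤
        ENNReal.ofReal C * ∫⁻ z in A, ENNReal.ofReal |z.1| := by
  obtain ⟨I, hI⟩ : ∃ I, I = ∫⁻ t, logKernel t := ⟨_, rfl⟩
  have hItop : 16 * I ≠ ⊤ := ENNReal.mul_ne_top (by simp) (hI ▸ lintegral_logKernel_ne_top)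
  refine ⟨(16 * I).toReal + 1, by positivity, fun A hA hsub => ?_⟩
  set f : Torus → ENNReal := fun y => volume {x : ℝ | (x, y) ∈ A} with hf
  have hfm : Measurable f := measurable_measure_prodMk_right hA
  have hslice (y : Torus) : volume {x : ℝ | (x, y) ∈ A} ≠ ⊤ := by
    refine ne_top_of_le_ne_top ?_ (measure_mono fun x (hx : (x, y) ∈ A) => (hsub hx).1)
    simp
  have hangular (g : Torus → ENNReal) (hg : Measurable g) :
      ∫⁻ z in A, g z.2 = ∫⁻ y, f y * g y := by
    rw [setLIntegral_strip A hA (fun z => g z.2) (hg.comp measurable_snd)]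
    simp [hf, mul_comm]
  have hKsub : Measurable fun p : Torus × Torus => logKernel (p.1 - p.2) :=
    measurable_logKernel.comp (measurable_fst.sub measurable_snd)
  have hinner (y : Torus) :
      ∫⁻ ξ in A, logKernel (y - ξ.2) = ∫⁻ y', f y' * logKernel (y - y') :=
    hangular (fun y' => logKernel (y - y')) (measurable_logKernel.comp (measurable_id.const_sub y))
  calc ∫⁻ z in A, ∫⁻ ξ in A,
          ENNReal.ofReal |Real.log (Real.sqrt ((z.1 - ξ.1) ^ 2 + ‖z.2 - ξ.2‖ ^ 2))|
      ≤ ∫⁻ z in A, ∫⁻ ξ in A, logKernel (z.2 - ξ.2) :=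
        setLIntegral_mono' hA fun z hz => setLIntegral_mono' hA fun ξ hξ =>
          abs_log_dist_le_logKernel z ξ (hsub hz).1 (hsub hξ).1
    _ = ∫⁻ z in A, ∫⁻ y', f y' * logKernel (z.2 - y') :=
        lintegral_congr fun z => hinner z.2
    _ = ∫⁻ y, f y * ∫⁻ y', f y' * logKernel (y - y') :=
        hangular (fun y => ∫⁻ y', f y' * logKernel (y - y'))
          (Measurable.lintegral_prod_right'
            (f := fun p : Torus × Torus => f p.2 * logKernel (p.1 - p.2))
            ((hfm.comp measurable_snd).mul hKsub))
    _ ≤ 2 * I * ∫⁻ y, f y ^ 2 :=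
        hI ▸ lintegral_mul_lintegral_sub_le volume logKernel f measurable_logKernel hfm
    _ ≤ 2 * I * ∫⁻ y, 8 * ∫⁻ x in {x : ℝ | (x, y) ∈ A}, ENNReal.ofReal |x| := by
        gcongr with y
        exact volume_sq_le_lintegral_abs _ (hslice y)
    _ = 16 * I * ∫⁻ z in A, ENNReal.ofReal |z.1| := by
        rw [lintegral_const_mul' _ _ (by simp),
          setLIntegral_strip A hA (fun z => ENNReal.ofReal |z.1|) (by fun_prop)]
        ring
    _ ≤ ENNReal.ofReal ((16 * I).toReal + 1) * ∫⁻ z in A, ENNReal.ofReal |z.1| := by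
        gcongr
        rw [← ENNReal.ofReal_toReal hItop]
        refine ENNReal.ofReal_le_ofReal ?_
        rw [ENNReal.ofReal_toReal hItop]
        linarith
end
end

section
/- There is an absolute constant C > 0 such that for every z = (x,y) ∈ S with z ≠ (0,0), writing |z| = √(x² + d_𝕋(y,0)²) with d_𝕋 the quotient metric on 𝕋, the function G(z) = log(cosh(x) − cos(y)) − |x| + log 2 satisfies: |G(z)| ≤ C·e^{−0.1|z|} whenever |z| > 1, and |G(z)| ≤ C·(1 + |log|z||) whenever 0 < |z| ≤ 1. Consequently ∫_S |G(z)| dz < ∞. -/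
open MeasureTheory Real

noncomputable section

/-- `G(z) = log(cosh x - cos y) - |x| + log 2` on the strip. -/
def Gfun (z : Strip) : ℝ := Real.log (Real.cosh z.1 - cosT z.2) - |z.1| + Real.log 2

theorem cosT_eq_cos_norm (w : Torus) : cosT w = Real.cos ‖w‖ := by
  induction w using QuotientAddGroup.induction_on with
  | H y =>
    change Real.cos y = Real.cos ‖(y : AddCircle (2 * π))‖
    rw [AddCircle.norm_eq, Real.cos_abs, Real.cos_sub_int_mul_two_pi]

theorem norm_torus_le_pi (w : Torus) : ‖w‖ ≤ π := by
  have h := AddCircle.norm_le_half_period (2 * π) (x := w) (by positivity)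
  rw [abs_of_pos (by positivity)] at h
  linarith

theorem one_add_sq_div_two_le_cosh (t : ℝ) : 1 + t ^ 2 / 2 ≤ Real.cosh t := by
  wlog ht : 0 ≤ t generalizing t
  · simpa using this (-t) (by linarith)
  have h : t / 2 ≤ Real.sinh (t / 2) := Real.self_le_sinh_iff.2 (by positivity)
  have h2 := Real.cosh_two_mul (t / 2)
  rw [Real.cosh_sq, mul_div_cancel₀ _ (two_ne_zero' ℝ)] at h2
  nlinarith

/-- The quantity `e^{G(z)}`, with `t = |x|` and `r = d_𝕋(y,0)`. -/
def expG (t r : ℝ) : ℝ := 2 * Real.exp (-t) * (Real.cosh t - Real.cos r)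

theorem expG_eq (t r : ℝ) :
    expG t r = (1 - Real.exp (-t)) ^ 2 + 2 * Real.exp (-t) * (1 - Real.cos r) := by
  have h : Real.exp t * Real.exp (-t) = 1 := by rw [← Real.exp_add]; simp
  rw [expG, Real.cosh_eq]
  linear_combination h

theorem le_expG {r : ℝ} (t : ℝ) (hr : |r| ≤ π) :
    Real.exp (-t) * (2 / 5) * (t ^ 2 + r ^ 2) ≤ expG t r := by
  have h1 := one_add_sq_div_two_le_cosh t
  have h2 := Real.cos_le_one_sub_mul_cos_sq hr
  have hpi : π ^ 2 ≤ 10 := by nlinarith [Real.pi_lt_d2, Real.pi_pos]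
  have h3 : (1 : ℝ) / 5 ≤ 2 / π ^ 2 := by
    rw [div_le_div_iff₀ (by norm_num) (by positivity)]
    linarith
  have h4 : (1 : ℝ) / 5 * (t ^ 2 + r ^ 2) ≤ Real.cosh t - Real.cos r := by
    nlinarith [sq_nonneg t, sq_nonneg r]
  rw [expG]
  nlinarith [Real.exp_pos (-t)]

theorem expG_pos {t r : ℝ} (hr : |r| ≤ π) (h : 0 < t ^ 2 + r ^ 2) : 0 < expG t r :=
  lt_of_lt_of_le (by positivity) (le_expG t hr)

theorem expG_le_four {t : ℝ} (r : ℝ) (ht : 0 ≤ t) : expG t r ≤ 4 := by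
  rw [expG_eq]
  have h1 : Real.exp (-t) ≤ 1 := by simpa using ht
  nlinarith [Real.exp_pos (-t), Real.neg_one_le_cos r]

theorem one_tenth_le_expG {t r : ℝ} (hr : |r| ≤ π) (h : 1 ≤ t ^ 2 + r ^ 2) :
    1 / 10 ≤ expG t r := by
  rcases le_total (Real.exp (-t)) (1 / 4) with hs | hs
  · rw [expG_eq]
    nlinarith [Real.exp_pos (-t), Real.cos_le_one r]
  · refine le_trans ?_ (le_expG t hr)
    nlinarith

theorem abs_expG_sub_one_le {t : ℝ} (r : ℝ) (ht : 0 ≤ t) :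
    |expG t r - 1| ≤ 3 * Real.exp (-t) := by
  have h1 : Real.exp (-t) ≤ 1 := by simpa using ht
  have h0 := Real.exp_pos (-t)
  rw [expG_eq, abs_le]
  constructor <;> nlinarith [Real.neg_one_le_cos r, Real.cos_le_one r]

theorem abs_log_expG_le_exp {t r : ℝ} (ht : 0 ≤ t) (hr : |r| ≤ π) (h : 1 ≤ t ^ 2 + r ^ 2) :
    |Real.log (expG t r)| ≤ 30 * Real.exp (-t) := by
  have hF := one_tenth_le_expG hr h
  have hpos : 0 < expG t r := by linarith
  obtain ⟨h1, h2⟩ := abs_le.1 (abs_expG_sub_one_le r ht)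
  have h0 := Real.exp_pos (-t)
  have hlow := Real.one_sub_inv_le_log_of_pos hpos
  have hup := Real.log_le_sub_one_of_pos hpos
  refine abs_le.2 ⟨le_trans ?_ hlow, by linarith⟩
  have h4 : 1 - (expG t r)⁻¹ = (expG t r - 1) / expG t r := by field_simp
  rw [h4, le_div_iff₀ hpos]
  nlinarith

theorem abs_log_expG_le_log {t r : ℝ} (ht : 0 ≤ t) (hr : |r| ≤ π) (h0 : 0 < t ^ 2 + r ^ 2)
    (h : t ^ 2 + r ^ 2 ≤ 1) :
    |Real.log (expG t r)| ≤ 100 * (1 + |Real.log (Real.sqrt (t ^ 2 + r ^ 2))|) := by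
  have ht1 : t ≤ 1 := by nlinarith [sq_nonneg r]
  have hpos := expG_pos hr h0
  have hs : 1 / 4 ≤ Real.exp (-t) := by
    have h3 : Real.exp (-1) ≤ Real.exp (-t) := Real.exp_le_exp.2 (by linarith)
    have h4 : 1 / 4 ≤ Real.exp (-1) := by
      have := Real.exp_neg_one_gt_d9
      linarith
    linarith
  have hlow : 1 / 10 * (t ^ 2 + r ^ 2) ≤ expG t r := by
    refine le_trans ?_ (le_expG t hr)
    nlinarith
  have hlog := Real.log_le_log (by positivity) hlow
  rw [Real.log_mul (by norm_num) h0.ne'] at hlog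
  have h10 := Real.one_sub_inv_le_log_of_pos (show (0 : ℝ) < 1 / 10 by norm_num)
  norm_num at h10
  have hup := Real.log_le_sub_one_of_pos hpos
  have hF := expG_le_four r ht
  rw [Real.log_sqrt h0.le]
  have ha := neg_abs_le (Real.log (t ^ 2 + r ^ 2) / 2)
  have hb := abs_nonneg (Real.log (t ^ 2 + r ^ 2) / 2)
  norm_num at hlog
  refine abs_le.2 ⟨by linarith, by linarith⟩

theorem abs_sq_add_norm_sq_pos {z : Strip} (hz : z ≠ ((0 : ℝ), (0 : Torus))) :
    0 < |z.1| ^ 2 + ‖z.2‖ ^ 2 := by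
  by_contra! hle
  have h1 : |z.1| = 0 := by nlinarith [sq_nonneg |z.1|, sq_nonneg ‖z.2‖]
  have h2 : ‖z.2‖ = 0 := by nlinarith [sq_nonneg |z.1|, sq_nonneg ‖z.2‖]
  exact hz (Prod.ext (abs_eq_zero.1 h1) (norm_eq_zero.1 h2))

theorem abs_norm_torus_le_pi (w : Torus) : |‖w‖| ≤ π := by
  rw [abs_norm]
  exact norm_torus_le_pi w

theorem Gfun_eq_log_expG {z : Strip} (hz : z ≠ ((0 : ℝ), (0 : Torus))) :
    Gfun z = Real.log (expG |z.1| ‖z.2‖) := by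
  have hpos := expG_pos (abs_norm_torus_le_pi z.2) (abs_sq_add_norm_sq_pos hz)
  rw [expG] at hpos ⊢
  have hd : 0 < Real.cosh |z.1| - Real.cos ‖z.2‖ := pos_of_mul_pos_right hpos (by positivity)
  rw [Real.log_mul (by positivity) hd.ne', Real.log_mul two_ne_zero (Real.exp_ne_zero _),
    Real.log_exp, Gfun, cosT_eq_cos_norm, Real.cosh_abs]
  ring

theorem abs_Gfun_le_exp {z : Strip} (hz : z ≠ ((0 : ℝ), (0 : Torus)))
    (h : 1 < Real.sqrt (z.1 ^ 2 + ‖z.2‖ ^ 2)) :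
    |Gfun z| ≤ 100 * Real.exp (-(0.1) * Real.sqrt (z.1 ^ 2 + ‖z.2‖ ^ 2)) := by
  have hsq : 1 ≤ |z.1| ^ 2 + ‖z.2‖ ^ 2 := by
    rw [sq_abs]
    exact (Real.lt_sqrt zero_le_one |>.1 h).le.trans' (by norm_num)
  rw [Gfun_eq_log_expG hz]
  refine (abs_log_expG_le_exp (abs_nonneg _) (abs_norm_torus_le_pi z.2) hsq).trans ?_
  have hρ : Real.sqrt (z.1 ^ 2 + ‖z.2‖ ^ 2) ≤ |z.1| + ‖z.2‖ := by
    refine Real.sqrt_le_iff.2 ⟨by positivity, ?_⟩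
    nlinarith [sq_abs z.1, mul_nonneg (abs_nonneg z.1) (norm_nonneg z.2)]
  have h4 : ‖z.2‖ ≤ 4 := (norm_torus_le_pi z.2).trans Real.pi_le_four
  have h5 : Real.exp (-|z.1|) ≤
      Real.exp 1 * Real.exp (-(0.1) * Real.sqrt (z.1 ^ 2 + ‖z.2‖ ^ 2)) := by
    rw [← Real.exp_add]
    refine Real.exp_le_exp.2 ?_
    have := abs_nonneg z.1
    linarith
  have h6 := Real.exp_one_lt_d9
  nlinarith [Real.exp_pos (-(0.1) * Real.sqrt (z.1 ^ 2 + ‖z.2‖ ^ 2))]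

theorem abs_Gfun_le_log {z : Strip} (hz : z ≠ ((0 : ℝ), (0 : Torus)))
    (h : Real.sqrt (z.1 ^ 2 + ‖z.2‖ ^ 2) ≤ 1) :
    |Gfun z| ≤ 100 * (1 + |Real.log (Real.sqrt (z.1 ^ 2 + ‖z.2‖ ^ 2))|) := by
  have h1 : |z.1| ^ 2 + ‖z.2‖ ^ 2 ≤ 1 := by
    rw [sq_abs]
    simpa using (Real.sqrt_le_iff.1 h).2
  have := abs_log_expG_le_log (abs_nonneg z.1) (abs_norm_torus_le_pi z.2)
    (abs_sq_add_norm_sq_pos hz) h1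
  rwa [sq_abs, ← Gfun_eq_log_expG hz] at this

/-- An integrable function of `x` alone that dominates `G`, up to a constant, off `x = 0`. -/
def majorant (x : ℝ) : ℝ :=
  Real.exp (-(0.1) * |x|) + (Set.Icc (-1 : ℝ) 1).indicator (fun u => 1 + |Real.log u|) x

theorem integrable_majorant : Integrable majorant := by
  refine Integrable.add ?_ ?_
  · rw [← integrableOn_univ, ← Set.Iic_union_Ioi (a := (0 : ℝ))]
    refine IntegrableOn.union ?_ ?_
    · refine (integrableOn_exp_mul_Iic (a := 0.1) (by norm_num) 0).congr_fun (fun x hx => ?_)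
        measurableSet_Iic
      simp only [abs_of_nonpos (Set.mem_Iic.1 hx), neg_mul_neg]
    · refine (integrableOn_exp_mul_Ioi (a := -(0.1)) (by norm_num) 0).congr_fun (fun x hx => ?_)
        measurableSet_Ioi
      simp only [abs_of_pos (Set.mem_Ioi.1 hx)]
  · refine IntegrableOn.integrable_indicator ?_ measurableSet_Icc
    refine Integrable.add (integrableOn_const (by simp)) (Integrable.abs ?_)
    exact (intervalIntegrable_iff_integrableOn_Icc_of_le (by norm_num)).1
      intervalIntegral.intervalIntegrable_log'

theorem abs_Gfun_le_majorant {z : Strip} (hx : z.1 ≠ 0) : |Gfun z| ≤ 100 * majorant z.1 := by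
  have hz : z ≠ ((0 : ℝ), (0 : Torus)) := fun h => hx (congrArg Prod.fst h)
  have hle : |z.1| ≤ Real.sqrt (z.1 ^ 2 + ‖z.2‖ ^ 2) :=
    Real.abs_le_sqrt (by linarith [sq_nonneg ‖z.2‖])
  have hexp := Real.exp_pos (-(0.1) * |z.1|)
  rcases lt_or_ge 1 (Real.sqrt (z.1 ^ 2 + ‖z.2‖ ^ 2)) with h | h
  · refine (abs_Gfun_le_exp hz h).trans ?_
    have h1 : Real.exp (-(0.1) * Real.sqrt (z.1 ^ 2 + ‖z.2‖ ^ 2)) ≤ Real.exp (-(0.1) * |z.1|) :=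
      Real.exp_le_exp.2 (by linarith)
    have h2 : 0 ≤ (Set.Icc (-1 : ℝ) 1).indicator (fun u => 1 + |Real.log u|) z.1 :=
      Set.indicator_nonneg (fun _ _ => by positivity) _
    rw [majorant]
    linarith
  · refine (abs_Gfun_le_log hz h).trans ?_
    rw [majorant, Set.indicator_of_mem (Set.mem_Icc.2 (abs_le.1 (hle.trans h)))]
    have h1 : Real.log |z.1| ≤ Real.log (Real.sqrt (z.1 ^ 2 + ‖z.2‖ ^ 2)) :=
      Real.log_le_log (abs_pos.2 hx) hle
    have h2 : Real.log (Real.sqrt (z.1 ^ 2 + ‖z.2‖ ^ 2)) ≤ 0 :=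
      Real.log_nonpos (Real.sqrt_nonneg _) h
    rw [abs_of_nonpos h2]
    have h3 := neg_le_abs (Real.log z.1)
    rw [Real.log_abs] at h1
    linarith

theorem lintegral_abs_Gfun_lt_top : ∫⁻ z : Strip, ENNReal.ofReal |Gfun z| < ⊤ := by
  have hint : Integrable (fun z : Strip => 100 * majorant z.1) :=
    (integrable_majorant.comp_fst (volume : Measure Torus)).const_mul 100
  refine lt_of_le_of_lt (lintegral_mono_ae ?_) hint.lintegral_lt_top
  have hne : ∀ᵐ x : ℝ, x ≠ 0 := Measure.ae_ne volume 0
  have hfst : ∀ᵐ z : Strip, z.1 ≠ 0 := Measure.quasiMeasurePreserving_fst.ae hne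
  filter_upwards [hfst] with z hz
  exact ENNReal.ofReal_le_ofReal (abs_Gfun_le_majorant hz)

/-- There is an absolute constant `C > 0` such that, with
`|z| = √(x² + d_𝕋(y,0)²)`, one has `|G(z)| ≤ C e^{-0.1|z|}` for `|z| > 1` and
`|G(z)| ≤ C(1 + |log|z||)` for `0 < |z| ≤ 1`; consequently `∫_S |G| dz < ∞`. -/
theorem stmt_14 :
    ∃ C > (0 : ℝ),
      (∀ z : Strip, z ≠ ((0 : ℝ), (0 : Torus)) →
        (1 < Real.sqrt (z.1 ^ 2 + ‖z.2‖ ^ 2) →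
          |Gfun z| ≤ C * Real.exp (-(0.1) * Real.sqrt (z.1 ^ 2 + ‖z.2‖ ^ 2))) ∧
        (Real.sqrt (z.1 ^ 2 + ‖z.2‖ ^ 2) ≤ 1 →
          |Gfun z| ≤ C * (1 + |Real.log (Real.sqrt (z.1 ^ 2 + ‖z.2‖ ^ 2))|))) ∧
      ∫⁻ z : Strip, ENNReal.ofReal |Gfun z| < ⊤ := by
  exact ⟨100, by norm_num, fun _ hz => ⟨abs_Gfun_le_exp hz, abs_Gfun_le_log hz⟩,
    lintegral_abs_Gfun_lt_top⟩
end
end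

section
/- Let Ψ : ℝ² → ℝ be twice continuously differentiable with ∂²Ψ/∂x² + ∂²Ψ/∂y² = 0 everywhere, satisfying Ψ(x, y+2π) = Ψ(x,y) for all (x,y), and |Ψ(x,y)| ≤ C(|x|+1) for some constant C and all (x,y). Suppose that for every y the limits lim_{x→+∞} ∂Ψ/∂x (x,y) and lim_{x→−∞} ∂Ψ/∂x (x,y) exist and satisfy lim_{x→+∞} ∂Ψ/∂x (x,y) = − lim_{x→−∞} ∂Ψ/∂x (x,y). Then Ψ is constant. -/
open Real Filter

open InnerProductSpace in
/-- A harmonic function on `ℂ` of at most linear growth is affine. -/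
theorem InnerProductSpace.HarmonicOnNhd.exists_eq_affine_of_linear_growth {f : ℂ → ℝ}
    (hf : HarmonicOnNhd f Set.univ) {C : ℝ} (hC : ∀ z, |f z| ≤ C * (‖z‖ + 1)) :
    ∃ m : ℂ, ∀ z, f z = f 0 + (m * z).re := by
  obtain ⟨F, hF, hFf⟩ := hf.exists_analyticOnNhd_univ_re_eq
  have hre : ∀ z, (F z).re = f z := fun z => congrFun hFf z
  have hd : Differentiable ℂ F := fun z => (hF z (Set.mem_univ z)).differentiableAt
  have hC0 : 0 ≤ C := by
    have := hC 0
    rw [norm_zero, zero_add, mul_one] at this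
    exact (abs_nonneg _).trans this
  set A : ℝ := 4 * C + 2 + 3 * ‖F 0‖ with hA
  have hA0 : 0 ≤ A := by positivity
  have hlin : ∀ z, ‖F z‖ ≤ A * (‖z‖ + 1) := by
    intro z
    have hz := norm_nonneg z
    have hF0 := norm_nonneg (F 0)
    have key := Complex.borelCaratheodory (f := F) (R := 2 * ‖z‖ + 1) (z := z)
      (M := C * (2 * ‖z‖ + 2) + 1) (by positivity) hd.differentiableOn
      (fun w hw => by
        have hw' : ‖w‖ < 2 * ‖z‖ + 1 := mem_ball_zero_iff.mp hw
        have h1 := (le_abs_self _).trans (hC w)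
        change (F w).re ≤ _
        rw [hre]
        nlinarith) (by positivity) (mem_ball_zero_iff.mpr (by linarith))
    have e : 2 * ‖z‖ + 1 - ‖z‖ = ‖z‖ + 1 := by ring
    rw [e, ← add_div] at key
    refine key.trans ?_
    rw [div_le_iff₀ (by positivity), hA]
    nlinarith [mul_nonneg hC0 hz, mul_nonneg hF0 hz, mul_nonneg hz hz,
      mul_nonneg hF0 (mul_nonneg hz hz), mul_nonneg hC0 (mul_nonneg hz hz)]
  have hbd : ∀ c, ‖deriv F c‖ ≤ 2 * A := by
    intro c
    have hc := norm_nonneg c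
    have key := Complex.norm_deriv_le_of_forall_mem_sphere_norm_le (c := c) (R := ‖c‖ + 1)
      (C := 2 * A * (‖c‖ + 1)) (f := F) (by positivity) hd.diffContOnCl (fun z hz => by
        have h1 : ‖z - c‖ = ‖c‖ + 1 := mem_sphere_iff_norm.mp hz
        have h2 : ‖z‖ ≤ ‖z - c‖ + ‖c‖ := by simpa using norm_add_le (z - c) c
        refine (hlin z).trans ?_
        nlinarith)
    rwa [mul_div_cancel_right₀ _ (by positivity)] at key
  have hconst : ∀ z, deriv F z = deriv F 0 := fun z =>
    Differentiable.apply_eq_apply_of_bounded (hd.deriv)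
      (isBounded_iff_forall_norm_le.mpr ⟨2 * A, by rintro _ ⟨c, rfl⟩; exact hbd c⟩) z 0
  refine ⟨deriv F 0, fun z => ?_⟩
  have hG : ∀ w, HasDerivAt (fun w => F w - deriv F 0 * w) 0 w := fun w => by
    have h := (hd w).hasDerivAt.sub ((hasDerivAt_id w).const_mul (deriv F 0))
    rwa [hconst w, mul_one, sub_self] at h
  have h := is_const_of_deriv_eq_zero (fun w => (hG w).differentiableAt)
    (fun w => (hG w).deriv) z 0
  have h' : F z = F 0 + deriv F 0 * z := by
    simp only [mul_zero, sub_zero] at h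
    linear_combination h
  rw [← hre z, ← hre 0, h', Complex.add_re]

/-- The derivative of `f` in the direction `1`, as a partial derivative. -/
theorem Complex.deriv_re_eq_fderiv {f : ℂ → ℝ} (hf : Differentiable ℝ f) (x y : ℝ) :
    deriv (fun t : ℝ => f ⟨t, y⟩) x = fderiv ℝ f ⟨x, y⟩ 1 := by
  have h : HasDerivAt (fun t : ℝ => (⟨t, y⟩ : ℂ)) 1 x := by
    have := (Complex.ofRealCLM.hasDerivAt (x := x)).add_const (y * Complex.I)
    simpa [Complex.mk_eq_add_mul_I] using this
  exact ((hf ⟨x, y⟩).hasFDerivAt.comp_hasDerivAt x h).deriv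

/-- The derivative of `f` in the direction `I`, as a partial derivative. -/
theorem Complex.deriv_im_eq_fderiv {f : ℂ → ℝ} (hf : Differentiable ℝ f) (x y : ℝ) :
    deriv (fun t : ℝ => f ⟨x, t⟩) y = fderiv ℝ f ⟨x, y⟩ Complex.I := by
  have h : HasDerivAt (fun t : ℝ => (⟨x, t⟩ : ℂ)) Complex.I y := by
    have := ((Complex.ofRealCLM.hasDerivAt (x := y)).mul_const Complex.I).const_add (x : ℂ)
    simpa [Complex.mk_eq_add_mul_I] using this
  exact ((hf ⟨x, y⟩).hasFDerivAt.comp_hasDerivAt y h).deriv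

open InnerProductSpace in
/-- A `C²` function on `ℂ` whose second partial derivatives sum to zero is harmonic. -/
theorem Complex.harmonicOnNhd_of_deriv_add_deriv_eq_zero {f : ℂ → ℝ} (hf : ContDiff ℝ 2 f)
    (h : ∀ x y : ℝ, deriv (fun t => deriv (fun u : ℝ => f ⟨u, y⟩) t) x +
      deriv (fun t => deriv (fun u : ℝ => f ⟨x, u⟩) t) y = 0) :
    HarmonicOnNhd f Set.univ := by
  have hd : Differentiable ℝ f := hf.differentiable two_ne_zero
  have hd' : Differentiable ℝ (fderiv ℝ f) :=
    (hf.fderiv_right (m := 1) (by norm_num)).differentiable one_ne_zero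
  have hv : ∀ v : ℂ, Differentiable ℝ (fun w => fderiv ℝ f w v) := fun v => by fun_prop
  have hsnd : ∀ v z : ℂ, fderiv ℝ (fun w => fderiv ℝ f w v) z v =
      fderiv ℝ (fderiv ℝ f) z v v := fun v z => by
    rw [fderiv_clm_apply (hd' z) (differentiableAt_const v)]
    simp
  refine fun z _ => ⟨hf.contDiffAt, Eventually.of_forall fun w => ?_⟩
  have hw := h w.re w.im
  simp only [Complex.deriv_re_eq_fderiv hd, Complex.deriv_im_eq_fderiv hd] at hw
  rw [Complex.deriv_re_eq_fderiv (hv 1), Complex.deriv_im_eq_fderiv (hv Complex.I),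
    hsnd, hsnd] at hw
  simpa [laplacian_eq_iteratedFDeriv_complexPlane, iteratedFDeriv_two_apply] using hw

/-- Let `Ψ : ℝ² → ℝ` be `C²` and harmonic, `2π`-periodic in the second
variable, with `|Ψ(x,y)| ≤ C(|x|+1)`.  Suppose that for each `y` the limits of `∂Ψ/∂x(x,y)` as
`x → ±∞` exist and `lim_{x→+∞} ∂Ψ/∂x = - lim_{x→-∞} ∂Ψ/∂x`.  Then `Ψ` is constant. -/
theorem stmt_16 (Ψ : ℝ × ℝ → ℝ) (hC2 : ContDiff ℝ 2 Ψ)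
    (hharm : ∀ x y : ℝ, deriv (fun t => deriv (fun u => Ψ (u, y)) t) x +
        deriv (fun t => deriv (fun u => Ψ (x, u)) t) y = 0)
    (hper : ∀ x y : ℝ, Ψ (x, y + 2 * π) = Ψ (x, y))
    (C : ℝ) (hgrow : ∀ x y : ℝ, |Ψ (x, y)| ≤ C * (|x| + 1))
    (hlim : ∀ y : ℝ, ∃ l : ℝ,
        Filter.Tendsto (fun x => deriv (fun u => Ψ (u, y)) x) Filter.atTop (nhds l) ∧
        Filter.Tendsto (fun x => deriv (fun u => Ψ (u, y)) x) Filter.atBot (nhds (-l))) :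
    ∃ c : ℝ, ∀ p : ℝ × ℝ, Ψ p = c := by
  have hC0 : 0 ≤ C := by simpa using (abs_nonneg _).trans (hgrow 0 0)
  have hf : ContDiff ℝ 2 (fun z : ℂ => Ψ (z.re, z.im)) :=
    hC2.comp (Complex.reCLM.contDiff.prodMk Complex.imCLM.contDiff)
  obtain ⟨m, hm⟩ := (Complex.harmonicOnNhd_of_deriv_add_deriv_eq_zero hf
    hharm).exists_eq_affine_of_linear_growth (C := C) fun z => (hgrow z.re z.im).trans <| by
      gcongr
      exact Complex.abs_re_le_norm z
  have hΨ : ∀ x y : ℝ, Ψ (x, y) = Ψ (0, 0) + (m.re * x - m.im * y) := fun x y => by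
    simpa using hm ⟨x, y⟩
  have him : m.im = 0 := by
    have h := hper 0 0
    rw [hΨ 0 (0 + 2 * π), hΨ 0 0] at h
    have : m.im * π = 0 := by linarith
    exact (mul_eq_zero.mp this).resolve_right pi_ne_zero
  have hderiv : ∀ x : ℝ, deriv (fun u => Ψ (u, 0)) x = m.re := fun x => by
    rw [funext fun u => hΨ u 0]
    simp
  obtain ⟨l, htop, hbot⟩ := hlim 0
  simp only [hderiv, tendsto_const_nhds_iff] at htop hbot
  have hre : m.re = 0 := by linarith
  exact ⟨Ψ (0, 0), fun ⟨x, y⟩ => by rw [hΨ x y, hre, him]; simp⟩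
end

section
/- For every a > 0 and every t ∈ ℝ, ∫_ℝ cos(t x)/(a² + x²) dx = (π/a)·e^{−a|t|}. -/
open MeasureTheory Real

open scoped FourierTransform

theorem integrable_and_integral_cexp_mul_I_sub_mul_abs {a : ℝ} (ha : 0 < a) (s : ℝ) :
    Integrable (fun v : ℝ => Complex.exp (s * v * Complex.I - a * |v|)) ∧
      ∫ v : ℝ, Complex.exp (s * v * Complex.I - a * |v|) = 2 * a / (a ^ 2 + s ^ 2) := by
  have hneg : (s * Complex.I - a).re < 0 := by simpa
  have hpos : 0 < (s * Complex.I + a).re := by simpa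
  have hright : Set.EqOn (fun v : ℝ => Complex.exp ((s * Complex.I - a) * v))
      (fun v : ℝ => Complex.exp (s * v * Complex.I - a * |v|)) (Set.Ioi 0) := by
    intro v hv
    simp only [abs_of_pos (Set.mem_Ioi.mp hv)]
    ring_nf
  have hleft : Set.EqOn (fun v : ℝ => Complex.exp ((s * Complex.I + a) * v))
      (fun v : ℝ => Complex.exp (s * v * Complex.I - a * |v|)) (Set.Iic 0) := by
    intro v hv
    simp only [abs_of_nonpos (Set.mem_Iic.mp hv), Complex.ofReal_neg]
    ring_nf
  have hIoi := (integrableOn_exp_mul_complex_Ioi hneg 0).congr_fun hright measurableSet_Ioi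
  have hIic := (integrableOn_exp_mul_complex_Iic hpos 0).congr_fun hleft measurableSet_Iic
  refine ⟨?_, ?_⟩
  · rw [← integrableOn_univ, ← Set.Iic_union_Ioi (a := (0 : ℝ))]
    exact hIic.union hIoi
  · rw [← intervalIntegral.integral_Iic_add_Ioi hIic hIoi,
      ← setIntegral_congr_fun measurableSet_Iic hleft,
      ← setIntegral_congr_fun measurableSet_Ioi hright,
      integral_exp_mul_complex_Iic hpos, integral_exp_mul_complex_Ioi hneg]
    have h₁ : (s * Complex.I - a : ℂ) ≠ 0 := fun h => by simp [h] at hneg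
    have h₂ : (s * Complex.I + a : ℂ) ≠ 0 := fun h => by simp [h] at hpos
    have h₃ : (a ^ 2 + s ^ 2 : ℂ) ≠ 0 := by
      have : a ^ 2 + s ^ 2 ≠ 0 := by positivity
      exact_mod_cast this
    simp only [Complex.ofReal_zero, mul_zero, Complex.exp_zero]
    field_simp
    linear_combination (-2 * a * s ^ 2 : ℂ) * Complex.I_sq

theorem fourier_cexp_neg_mul_abs {a : ℝ} (ha : 0 < a) (w : ℝ) :
    𝓕 (fun v : ℝ => Complex.exp (-a * |v|)) w = 2 * a / (a ^ 2 + (2 * π * w) ^ 2) := by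
  have h := (integrable_and_integral_cexp_mul_I_sub_mul_abs ha (-(2 * π * w))).2
  rw [fourier_real_eq_integral_exp_smul]
  push_cast [neg_sq] at h
  rw [← h]
  congr 1 with v
  rw [smul_eq_mul, ← Complex.exp_add]
  push_cast
  ring_nf

theorem integrable_inv_sq_add_sq {a : ℝ} (ha : 0 < a) :
    Integrable fun x : ℝ => (a ^ 2 + x ^ 2)⁻¹ := by
  convert (integrable_inv_one_add_sq.comp_mul_left' (inv_ne_zero ha.ne')).const_mul (a ^ 2)⁻¹
    using 2 with x
  field_simp

theorem integral_cexp_mul_I_div_sq_add_sq {a : ℝ} (ha : 0 < a) (t : ℝ) :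
    ∫ x : ℝ, Complex.exp (t * x * Complex.I) / (a ^ 2 + x ^ 2) =
      π / a * Complex.exp (-a * |t|) := by
  have hf : Integrable fun v : ℝ => Complex.exp (-a * |v|) := by
    simpa using (integrable_and_integral_cexp_mul_I_sub_mul_abs ha 0).1
  have hF : Integrable (𝓕 fun v : ℝ => Complex.exp (-a * |v|)) := by
    have h := (((integrable_inv_sq_add_sq ha).comp_mul_left'
      two_pi_pos.ne').const_mul (2 * a)).ofReal (𝕜 := ℂ)
    refine h.congr (.of_forall fun w => ?_)
    rw [fourier_cexp_neg_mul_abs ha]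
    push_cast
    exact (div_eq_mul_inv _ _).symm
  have hinv := congrFun (Continuous.fourierInv_fourier_eq (by fun_prop) hf hF) t
  rw [Real.fourierInv_eq'] at hinv
  have hscale := Measure.integral_comp_mul_left
    (fun x : ℝ => Complex.exp (t * x * Complex.I) / (a ^ 2 + x ^ 2 : ℂ)) (2 * π)
  have hπ : (π : ℂ) ≠ 0 := by exact_mod_cast pi_ne_zero
  have ha' : (a : ℂ) ≠ 0 := by exact_mod_cast ha.ne'
  have hkey : ∫ v : ℝ, Complex.exp (↑(2 * π * inner ℝ v t) * Complex.I) •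
      𝓕 (fun v : ℝ => Complex.exp (-a * |v|)) v =
      2 * a * ∫ x : ℝ, Complex.exp (t * ↑(2 * π * x) * Complex.I) /
        (a ^ 2 + (↑(2 * π * x) : ℂ) ^ 2) := by
    rw [← integral_const_mul]
    congr 1 with v
    rw [fourier_cexp_neg_mul_abs ha, smul_eq_mul, RCLike.inner_apply, conj_trivial]
    push_cast
    ring_nf
  rw [hkey, hscale, abs_of_pos (by positivity), Complex.real_smul] at hinv
  rw [← hinv]
  generalize (∫ y : ℝ, _ : ℂ) = J
  push_cast
  field_simp

/-- For every `a > 0` and every `t ∈ ℝ`,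
`∫_ℝ cos(tx)/(a² + x²) dx = (π/a)·e^{-a|t|}`. -/
theorem stmt_17 (a : ℝ) (ha : 0 < a) (t : ℝ) :
    ∫ x : ℝ, Real.cos (t * x) / (a ^ 2 + x ^ 2) = π / a * Real.exp (-a * |t|) := by
  have hint : Integrable fun x : ℝ =>
      Complex.exp (t * x * Complex.I) / (a ^ 2 + x ^ 2 : ℂ) := by
    refine (integrable_inv_sq_add_sq ha).ofReal (𝕜 := ℂ) |>.bdd_mul (c := 1)
      (f := fun x : ℝ => Complex.exp (t * x * Complex.I)) (by fun_prop)
      (.of_forall fun x => ?_) |>.congr (.of_forall fun x => ?_)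
    · exact_mod_cast (Complex.norm_exp_ofReal_mul_I (t * x)).le
    · simp [div_eq_mul_inv]
  have h := congrArg Complex.re (integral_cexp_mul_I_div_sq_add_sq ha t)
  rw [← RCLike.re_eq_complex_re, ← integral_re hint] at h
  convert h using 1
  · congr 1 with x
    rw [RCLike.re_eq_complex_re]
    norm_cast
    rw [Complex.div_ofReal_re, Complex.exp_ofReal_mul_I_re]
  · rw [RCLike.re_eq_complex_re]
    norm_cast
end

section
/- The functions g₁(x,y) = sin(y)/(2(cosh(x) − cos(y))) and g₂(x,y) = sinh(x)/(2(cosh(x) − cos(y))) − sgn(x)/2 are integrable on S = ℝ × 𝕋, i.e. ∫_S |g₁(z)| dz < ∞ and ∫_S |g₂(z)| dz < ∞. -/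
open MeasureTheory Real

noncomputable section

/-- If `t ↦ f |t|` is integrable on the positive half-line, it is integrable on `ℝ`. -/
theorem integrable_comp_abs_of_integrableOn_Ioi {f : ℝ → ℝ} (hf : IntegrableOn f (Set.Ioi 0)) :
    Integrable (fun x => f |x|) := by
  have hpos : IntegrableOn (fun x => f |x|) (Set.Ioi 0) :=
    hf.congr_fun (fun x hx => by simp only [abs_of_pos (Set.mem_Ioi.mp hx)]) measurableSet_Ioi
  have hneg : IntegrableOn (fun x => f |x|) (Set.Iic 0) := by
    rw [integrableOn_Iic_iff_integrableOn_Iio]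
    have h := hpos
    rw [← neg_zero] at h
    simpa only [abs_neg] using h.comp_neg_Iio
  rw [← integrableOn_univ, ← Set.Iic_union_Ioi (a := (0 : ℝ))]
  exact hneg.union hpos

theorem integrable_inv_sqrt_abs_mul_exp_neg {b : ℝ} (hb : 0 < b) :
    Integrable (fun x : ℝ => (√|x|)⁻¹ * exp (-b * |x|)) := by
  apply integrable_comp_abs_of_integrableOn_Ioi (f := fun x => (√x)⁻¹ * exp (-b * x))
  refine (integrableOn_rpow_mul_exp_neg_mul_rpow (s := -(1 / 2)) (p := 1) (by norm_num)
    one_pos hb).congr_fun (fun x hx => ?_) measurableSet_Ioi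
  simp only [rpow_one, rpow_neg (Set.mem_Ioi.mp hx).le, sqrt_eq_rpow]

theorem inv_sqrt_le_of_mul_exp_le {t u b : ℝ} (ht : t ≠ 0)
    (h : |t| * exp (2 * (b * |t|)) / 4 ≤ u) :
    (√u)⁻¹ ≤ 2 * ((√|t|)⁻¹ * exp (-b * |t|)) := by
  have hp : 0 < √|t| := sqrt_pos.mpr (abs_pos.mpr ht)
  have hle : √|t| * exp (b * |t|) / 2 ≤ √u := by
    apply le_sqrt_of_sq_le
    rw [div_pow, mul_pow, sq_sqrt (abs_nonneg t), ← exp_nat_mul]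
    norm_num
    exact h
  calc (√u)⁻¹ ≤ (√|t| * exp (b * |t|) / 2)⁻¹ := by
        apply inv_anti₀ _ hle
        positivity
    _ = 2 * ((√|t|)⁻¹ * exp (-b * |t|)) := by
        rw [neg_mul, exp_neg]
        field_simp

theorem abs_mul_exp_le_abs_sinh_half (x : ℝ) :
    |x| * exp (2 * (1 / 8 * |x|)) / 4 ≤ |sinh (x / 2)| := by
  have hx := abs_nonneg x
  have h1 : |x| / 4 ≤ sinh (|x| / 4) := self_le_sinh_iff.mpr (by positivity)
  have h2 : exp (|x| / 4) / 2 ≤ cosh (|x| / 4) := by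
    rw [cosh_eq]
    linarith [exp_pos (-(|x| / 4))]
  have h3 : |sinh (x / 2)| = 2 * sinh (|x| / 4) * cosh (|x| / 4) := by
    rw [abs_sinh, ← sinh_two_mul, abs_div, abs_two]
    ring_nf
  have h4 := mul_le_mul h1 h2 (by positivity) (by linarith)
  rw [h3, show 2 * (1 / 8 * |x|) = |x| / 4 by ring]
  linarith

theorem integrable_inv_sqrt_abs_sinh_half :
    Integrable (fun x : ℝ => (√|sinh (x / 2)|)⁻¹) := by
  refine ((integrable_inv_sqrt_abs_mul_exp_neg (b := 1 / 8) (by norm_num)).const_mul 2).mono'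
    (by fun_prop) ?_
  refine Filter.Eventually.of_forall fun x => ?_
  rw [norm_of_nonneg (by positivity)]
  rcases eq_or_ne x 0 with h | h
  · simp [h]
  · exact inv_sqrt_le_of_mul_exp_le h (abs_mul_exp_le_abs_sinh_half x)

theorem abs_div_four_le_abs_sin_half {y : ℝ} (hy : |y| ≤ π) : |y| / 4 ≤ |sin (y / 2)| := by
  have h0 := abs_nonneg y
  have h := mul_le_sin (x := |y| / 2) (by positivity) (by linarith)
  have h1 : |y| / 4 ≤ 2 / π * (|y| / 2) := by
    rw [show 2 / π * (|y| / 2) = |y| / π by ring]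
    exact div_le_div_of_nonneg_left h0 pi_pos pi_le_four
  refine (h1.trans h).trans ?_
  rcases abs_choice y with hc | hc
  · rw [hc]
    exact le_abs_self _
  · rw [hc, neg_div, sin_neg]
    exact neg_le_abs _

theorem continuous_cosT : Continuous cosT :=
  continuous_coinduced_dom.mpr continuous_cos

theorem continuous_sinT : Continuous sinT :=
  continuous_coinduced_dom.mpr continuous_sin

theorem cosT_coe (y : ℝ) : cosT (y : Torus) = cos y := rfl

/-- The function `|sin (y / 2)|`, well-defined on `𝕋`. -/
def absSinHalf (y : Torus) : ℝ := √((1 - cosT y) / 2)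

theorem absSinHalf_coe (y : ℝ) : absSinHalf (y : Torus) = |sin (y / 2)| := by
  rw [absSinHalf, cosT_coe, abs_sin_half]

theorem measurable_absSinHalf : Measurable absSinHalf := by
  have := continuous_cosT.measurable
  unfold absSinHalf
  fun_prop

theorem ae_torus_of_ae_restrict {p : Torus → Prop} (hp : MeasurableSet {y | p y})
    (h : ∀ᵐ y : ℝ ∂volume.restrict (Set.Ioc (-π) (-π + 2 * π)), p (y : Torus)) : ∀ᵐ y, p y := by
  have hm := AddCircle.measurePreserving_mk (2 * π) (-π)
  rw [← hm.map_eq]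
  exact (ae_map_iff hm.measurable.aemeasurable hp).mpr h

theorem ae_absSinHalf_ne_zero : ∀ᵐ y, absSinHalf y ≠ 0 := by
  apply ae_torus_of_ae_restrict
  · exact measurable_absSinHalf (measurableSet_singleton 0).compl
  filter_upwards [ae_restrict_mem measurableSet_Ioc, ae_restrict_of_ae (volume.ae_ne (0 : ℝ))]
    with y hy hy0
  have := abs_div_four_le_abs_sin_half (y := y) (abs_le.mpr ⟨hy.1.le, by linarith [hy.2]⟩)
  have := abs_pos.mpr hy0
  rw [absSinHalf_coe]
  linarith

theorem integrable_inv_sqrt_absSinHalf : Integrable (fun y => (√(absSinHalf y))⁻¹) := by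
  have hm := AddCircle.measurePreserving_mk (2 * π) (-π)
  have hmeas := measurable_absSinHalf
  rw [← hm.integrable_comp (by fun_prop)]
  refine (((integrable_inv_sqrt_abs_mul_exp_neg one_pos).const_mul
    (2 * exp π)).integrableOn (s := Set.Ioc (-π) (-π + 2 * π))).mono' ?_ ?_
  · exact ((hmeas.sqrt.inv).comp hm.measurable).aestronglyMeasurable
  filter_upwards [ae_restrict_mem measurableSet_Ioc] with y hy
  have hy' : |y| ≤ π := abs_le.mpr ⟨hy.1.le, by linarith [hy.2]⟩
  rw [norm_of_nonneg (by simp only [Function.comp_apply]; positivity)]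
  simp only [Function.comp_apply, absSinHalf_coe]
  have hb := abs_div_four_le_abs_sin_half hy'
  rcases eq_or_ne y 0 with h | h
  · simp [h]
  refine (inv_sqrt_le_of_mul_exp_le (b := 0) h (by simpa using hb)).trans ?_
  have h1 : 1 ≤ exp π * exp (-1 * |y|) := by
    rw [← exp_add]
    exact one_le_exp (by linarith)
  have h2 : 0 ≤ 2 * (√|y|)⁻¹ := by positivity
  have := mul_le_mul_of_nonneg_left h1 h2
  simp only [neg_zero, zero_mul, exp_zero]
  linarith

theorem div_pow_four_add_pow_four_le {p q : ℝ} (hp : 0 < p) (hq : 0 < q) :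
    q ^ 2 / (p ^ 4 + q ^ 4) ≤ p⁻¹ * q⁻¹ := by
  rw [← mul_inv, ← one_div, div_le_div_iff₀ (by positivity) (by positivity)]
  nlinarith [mul_nonneg (sq_nonneg (p - q)) (sq_nonneg q), sq_nonneg (p ^ 2 - q ^ 2),
    sq_nonneg (p * q - q ^ 2), sq_nonneg (p ^ 2), sq_nonneg (p * q)]

theorem div_sq_add_sq_le {a s : ℝ} (ha : 0 < a) (hs : 0 < s) :
    s / (a ^ 2 + s ^ 2) ≤ (√a)⁻¹ * (√s)⁻¹ := by
  have h := div_pow_four_add_pow_four_le (sqrt_pos.mpr ha) (sqrt_pos.mpr hs)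
  have h4 : ∀ t : ℝ, 0 < t → √t ^ 4 = t ^ 2 := fun t ht => by
    rw [show 4 = 2 * 2 from rfl, pow_mul, sq_sqrt ht.le]
  rwa [h4 a ha, h4 s hs, sq_sqrt hs.le] at h

theorem cosh_sub_cos (x y : ℝ) :
    cosh x - cos y = 2 * (|sinh (x / 2)| ^ 2 + |sin (y / 2)| ^ 2) := by
  have h1 : cosh x = 1 + 2 * sinh (x / 2) ^ 2 := by
    conv_lhs => rw [show x = 2 * (x / 2) by ring, cosh_two_mul, cosh_sq]
    ring
  have h2 : cos y = 1 - 2 * sin (y / 2) ^ 2 := by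
    conv_lhs => rw [show y = 2 * (y / 2) by ring, cos_two_mul, cos_sq']
    ring
  rw [h1, h2, sq_abs, sq_abs]
  ring

theorem abs_sin_div_le {x y : ℝ} (hx : 0 < |sinh (x / 2)|) (hy : 0 < |sin (y / 2)|) :
    |sin y / (2 * (cosh x - cos y))| ≤ (√|sinh (x / 2)|)⁻¹ * (√|sin (y / 2)|)⁻¹ := by
  refine le_trans ?_ (div_sq_add_sq_le hx hy)
  have hsin : |sin y| ≤ 2 * |sin (y / 2)| := by
    conv_lhs => rw [show y = 2 * (y / 2) by ring, sin_two_mul, abs_mul, abs_mul, abs_two]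
    exact mul_le_of_le_one_right (by positivity) (abs_cos_le_one _)
  have hD : 0 < |sinh (x / 2)| ^ 2 + |sin (y / 2)| ^ 2 := by positivity
  rw [cosh_sub_cos, abs_div, abs_of_pos (show 0 < 2 * (2 * (|sinh (x / 2)| ^ 2 +
    |sin (y / 2)| ^ 2)) by positivity), div_le_div_iff₀ (by positivity) hD]
  nlinarith

theorem abs_sinh_sub_sign_mul_le (x y : ℝ) :
    |sinh x - Real.sign x * (cosh x - cos y)| ≤ 2 * |sinh (x / 2)| + 2 * |sin (y / 2)| := by
  have hs1 := abs_sin_le_one (y / 2)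
  have hs0 := abs_nonneg (sin (y / 2))
  have hc : 1 - cos y = 2 * |sin (y / 2)| ^ 2 := by
    simpa using cosh_sub_cos 0 y
  have key : ∀ t : ℝ, 0 ≤ t →
      |sinh t - (cosh t - cos y)| ≤ 2 * |sinh (t / 2)| + 2 * |sin (y / 2)| := by
    intro t ht
    have h1 : cosh t - sinh t = exp (-t) := cosh_sub_sinh t
    have h2 : 1 - exp (-t) = 2 * (exp (-(t / 2)) * sinh (t / 2)) := by
      rw [sinh_eq, show -t = -(t / 2) + -(t / 2) by ring, exp_add]
      have : exp (-(t / 2)) * exp (t / 2) = 1 := by rw [← exp_add]; simp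
      linear_combination -this
    have h3 : exp (-(t / 2)) ≤ 1 := exp_le_one_iff.mpr (by linarith)
    have h4 : 0 ≤ sinh (t / 2) := sinh_nonneg_iff.mpr (by linarith)
    have h5 := exp_pos (-(t / 2))
    rw [abs_of_nonneg h4, abs_le]
    constructor <;> nlinarith [mul_nonneg h5.le h4]
  rcases lt_trichotomy x 0 with hx | hx | hx
  · have h := key (-x) (by linarith)
    rw [sinh_neg, cosh_neg, neg_div, sinh_neg, abs_neg] at h
    rw [sign_of_neg hx, ← abs_neg]
    convert h using 2
    ring
  · subst hx
    simp
  · rw [sign_of_pos hx, one_mul]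
    exact key x hx.le

theorem abs_sinh_div_sub_sign_le {x y : ℝ} (hx : 0 < |sinh (x / 2)|) (hy : 0 < |sin (y / 2)|) :
    |sinh x / (2 * (cosh x - cos y)) - Real.sign x / 2| ≤
      (√|sinh (x / 2)|)⁻¹ * (√|sin (y / 2)|)⁻¹ := by
  have h1 := div_sq_add_sq_le hx hy
  have h2 := div_sq_add_sq_le hy hx
  have h3 := abs_sinh_sub_sign_mul_le x y
  have hcc := cosh_sub_cos x y
  set D := |sinh (x / 2)| ^ 2 + |sin (y / 2)| ^ 2 with hD
  have hDpos : 0 < D := by positivity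
  have hne : cosh x - cos y ≠ 0 := by rw [hcc]; positivity
  rw [add_comm, ← hD, mul_comm (√|sin (y / 2)|)⁻¹] at h2
  have heq : sinh x / (2 * (cosh x - cos y)) - Real.sign x / 2 =
      (sinh x - Real.sign x * (cosh x - cos y)) / (2 * (cosh x - cos y)) := by
    field_simp
  rw [heq, abs_div]
  have habs : |2 * (cosh x - cos y)| = 4 * D := by
    rw [hcc, abs_of_pos (by positivity)]
    ring
  rw [habs]
  calc _ ≤ (2 * |sinh (x / 2)| + 2 * |sin (y / 2)|) / (4 * D) := by gcongr
    _ = (|sinh (x / 2)| / D + |sin (y / 2)| / D) / 2 := by field_simp; ring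
    _ ≤ _ := by linarith

theorem integrable_strip_of_norm_le {f : Strip → ℝ} (hf : Measurable f)
    (h : ∀ x y : ℝ, 0 < |sinh (x / 2)| → 0 < |sin (y / 2)| →
      |f (x, (y : Torus))| ≤ (√|sinh (x / 2)|)⁻¹ * (√|sin (y / 2)|)⁻¹) :
    Integrable f volume := by
  refine (integrable_inv_sqrt_abs_sinh_half.mul_prod integrable_inv_sqrt_absSinHalf).mono'
    hf.aestronglyMeasurable ?_
  have hx : ∀ᵐ z : Strip, z.1 ≠ 0 :=
    Measure.quasiMeasurePreserving_fst.ae (volume.ae_ne (0 : ℝ))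
  have hy : ∀ᵐ z : Strip, absSinHalf z.2 ≠ 0 :=
    Measure.quasiMeasurePreserving_snd.ae ae_absSinHalf_ne_zero
  filter_upwards [hx, hy]
  rintro ⟨x, y⟩ hx hy
  induction y using QuotientAddGroup.induction_on with | H y =>
  simp only [absSinHalf_coe] at hx hy ⊢
  refine h x y (abs_pos.mpr ?_) (lt_of_le_of_ne (abs_nonneg _) hy.symm)
  rw [Ne, sinh_eq_zero]
  simpa using hx

theorem measurable_sign_real : Measurable Real.sign := by
  unfold Real.sign
  exact Measurable.ite measurableSet_Iio measurable_const
    (Measurable.ite measurableSet_Ioi measurable_const measurable_const)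

/-- The functions `g₁(x,y) = sin y/(2(cosh x - cos y))` and
`g₂(x,y) = sinh x/(2(cosh x - cos y)) - sgn(x)/2` are integrable on `S = ℝ × 𝕋`. -/
theorem stmt_18 :
    Integrable (fun z : Strip => sinT z.2 / (2 * (Real.cosh z.1 - cosT z.2))) volume ∧
    Integrable (fun z : Strip =>
      Real.sinh z.1 / (2 * (Real.cosh z.1 - cosT z.2)) - Real.sign z.1 / 2) volume := by
  have hc := continuous_cosT.measurable
  have hs := continuous_sinT.measurable
  have hsign := measurable_sign_real
  exact ⟨integrable_strip_of_norm_le (by fun_prop) fun _ _ => abs_sin_div_le,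
    integrable_strip_of_norm_le (by fun_prop) fun _ _ => abs_sinh_div_sub_sign_le⟩
end
end

section
/- There is an absolute constant C > 0 such that: (i) for every measurable set A ⊆ S with finite measure, ∫_A ∫_A |K(z,ξ)| dz dξ ≤ C·|A|; and (ii) if in addition 0 < |A| < 1/2, then ∫_A ∫_A |K(z,ξ)| dz dξ ≤ C·|A|²·(1 + |log|A||). -/
open MeasureTheory Real

noncomputable section

/-- The integrable majorant `e^{-|x|} / √(1 - e^{-|x|})` on `ℝ`. -/
def expMajorant (x : ℝ) : ℝ := Real.exp (-|x|) / √(1 - Real.exp (-|x|))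

lemma expMajorant_nonneg (x : ℝ) : 0 ≤ expMajorant x := by
  unfold expMajorant; positivity

lemma measurable_expMajorant : Measurable expMajorant := by
  unfold expMajorant; fun_prop

lemma integrable_expMajorant : Integrable expMajorant := by
  have h : IntegrableOn (fun t : ℝ => Real.exp (-t) / √(1 - Real.exp (-t))) (Set.Ioi 0) := by
    refine integrableOn_Ioi_deriv_of_nonneg (g := fun t => 2 * √(1 - Real.exp (-t))) (l := 2)
      (by fun_prop) ?_ (fun x _ => by positivity) ?_
    · intro x hx
      have hx' : Real.exp (-x) < 1 := by simpa using hx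
      have h1 : HasDerivAt (fun t : ℝ => 1 - Real.exp (-t)) (Real.exp (-x)) x := by
        simpa using ((hasDerivAt_neg x).exp).const_sub 1
      exact ((h1.sqrt (by linarith)).const_mul 2).congr_deriv (by field_simp)
    · have h0 : Filter.Tendsto (fun t : ℝ => Real.exp (-t)) Filter.atTop (nhds 0) :=
        Real.tendsto_exp_neg_atTop_nhds_zero
      simpa using ((h0.const_sub 1).sqrt).const_mul 2
  have h' : IntegrableOn expMajorant (Set.Ioi 0) := by
    refine h.congr_fun (fun t ht => ?_) measurableSet_Ioi
    simp only [expMajorant, abs_of_pos (Set.mem_Ioi.1 ht)]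
  have hneg : IntegrableOn expMajorant (Set.Iic 0) := by
    rw [integrableOn_Iic_iff_integrableOn_Iio]
    have := h'.comp_neg
    have heven : (fun x => expMajorant (-x)) = expMajorant := by
      ext x; simp [expMajorant]
    rwa [heven, Set.neg_Ioi, neg_zero] at this
  rw [← integrableOn_univ, ← Set.Iic_union_Ioi (a := (0 : ℝ))]
  exact hneg.union h'

lemma lintegral_strip_expMajorant_lt_top :
    ∫⁻ ξ : Strip, ENNReal.ofReal (expMajorant ξ.1) < ⊤ := by
  have hm : Measurable fun x : ℝ => ENNReal.ofReal (expMajorant x) :=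
    measurable_expMajorant.ennreal_ofReal
  have hm' : Measurable fun ξ : Strip => ENNReal.ofReal (expMajorant ξ.1) :=
    hm.comp measurable_fst
  rw [Measure.volume_eq_prod, lintegral_prod _ hm'.aemeasurable]
  simp only [lintegral_const]
  rw [lintegral_mul_const _ hm]
  exact ENNReal.mul_lt_top integrable_expMajorant.lintegral_lt_top (measure_lt_top _ _)

lemma abs_log_cosh_sub_le {x c : ℝ} (hx : x ≠ 0) (hc : |c| ≤ 1) :
    |Real.log (Real.cosh x - c) - |x| + Real.log 2| ≤ 4 * Real.log (1 + expMajorant x) := by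
  obtain ⟨hc1, hc2⟩ := abs_le.1 hc
  set r := Real.exp (-|x|) with hr
  have hr0 : 0 < r := Real.exp_pos _
  have hr1 : r < 1 := by simpa [hr] using hx
  have hcosh : 2 * (Real.cosh x - c) * r = 1 - 2 * r * c + r ^ 2 := by
    rw [← Real.cosh_abs, Real.cosh_eq, ← hr]
    have : Real.exp |x| * r = 1 := by rw [hr, ← Real.exp_add]; simp
    linear_combination this
  have hpos : 0 < Real.cosh x - c := by
    have := Real.one_lt_cosh.2 hx
    linarith
  have hlow : (1 - r) ^ 2 ≤ 1 - 2 * r * c + r ^ 2 := by nlinarith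
  have hupp : 1 - 2 * r * c + r ^ 2 ≤ (1 + r) ^ 2 := by nlinarith
  have hlog : Real.log (Real.cosh x - c) - |x| + Real.log 2
      = Real.log (1 - 2 * r * c + r ^ 2) := by
    rw [← hcosh, Real.log_mul (by positivity) hr0.ne', Real.log_mul two_ne_zero hpos.ne', hr,
      Real.log_exp]
    ring
  have hs0 : 0 < √(1 - r) := Real.sqrt_pos.2 (by linarith)
  have hs2 : √(1 - r) ^ 2 = 1 - r := Real.sq_sqrt (by linarith)
  have hs1 : √(1 - r) ≤ 1 := Real.sqrt_le_one.2 (by linarith)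
  have hG : (√(1 - r))⁻¹ ≤ 1 + expMajorant x := by
    rw [expMajorant, ← hr, inv_eq_one_div, div_le_iff₀ hs0]
    field_simp
    nlinarith
  have hlogG : -(2 * Real.log (1 - r)) ≤ 4 * Real.log (1 + expMajorant x) := by
    have h := Real.log_le_log (by positivity) hG
    rw [Real.log_inv, Real.log_sqrt (by linarith)] at h
    linarith
  have hD : 0 < (1 - r) ^ 2 := pow_pos (by linarith) 2
  have h1 := Real.log_le_log hD hlow
  have h2 := Real.log_le_log (hD.trans_le hlow) hupp
  rw [Real.log_pow] at h1 h2
  have h3 : Real.log (1 + r) + Real.log (1 - r) ≤ 0 := by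
    rw [← Real.log_mul (by linarith) (by linarith)]
    exact Real.log_nonpos (by nlinarith) (by nlinarith)
  push_cast at h1 h2
  rw [hlog]
  refine le_trans (abs_le.2 ⟨?_, ?_⟩) hlogG <;> linarith

lemma ae_abs_Kker_le (z : Strip) :
    ∀ᵐ ξ : Strip, |Kker z ξ| ≤ 4 * Real.log (1 + expMajorant (z.1 - ξ.1)) := by
  have h : ∀ᵐ ξ : Strip, ξ.1 ≠ z.1 :=
    Measure.quasiMeasurePreserving_fst.ae (Measure.ae_ne volume z.1)
  filter_upwards [h] with ξ hξ
  exact abs_log_cosh_sub_le (sub_ne_zero.2 hξ.symm) (abs_cosT_le_one _)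

lemma setLIntegral_expMajorant_sub_le (z : Strip) (A : Set Strip) :
    ∫⁻ ξ in A, ENNReal.ofReal (expMajorant (z.1 - ξ.1))
      ≤ ∫⁻ ξ : Strip, ENNReal.ofReal (expMajorant ξ.1) := by
  have : (volume : Measure Strip).IsAddHaarMeasure :=
    inferInstanceAs ((volume : Measure ℝ).prod (volume : Measure Torus)).IsAddHaarMeasure
  exact (setLIntegral_le_lintegral _ _).trans_eq
    (lintegral_sub_left_eq_self (fun ξ : Strip => ENNReal.ofReal (expMajorant ξ.1)) z)

lemma setLIntegral_abs_Kker_le (z : Strip) (A : Set Strip) :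
    ∫⁻ ξ in A, ENNReal.ofReal |Kker z ξ|
      ≤ 4 * ∫⁻ ξ : Strip, ENNReal.ofReal (expMajorant ξ.1) := by
  calc ∫⁻ ξ in A, ENNReal.ofReal |Kker z ξ|
      ≤ ∫⁻ ξ in A, 4 * ENNReal.ofReal (expMajorant (z.1 - ξ.1)) := by
        refine lintegral_mono_ae ((ae_restrict_of_ae (ae_abs_Kker_le z)).mono fun ξ hξ => ?_)
        rw [← ENNReal.ofReal_ofNat 4, ← ENNReal.ofReal_mul (by norm_num)]
        refine ENNReal.ofReal_le_ofReal (hξ.trans ?_)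
        have h0 := expMajorant_nonneg (z.1 - ξ.1)
        have := Real.log_le_sub_one_of_pos (x := 1 + expMajorant (z.1 - ξ.1)) (by linarith)
        linarith
    _ = 4 * ∫⁻ ξ in A, ENNReal.ofReal (expMajorant (z.1 - ξ.1)) :=
        lintegral_const_mul' _ _ (by norm_num)
    _ ≤ _ := by grw [setLIntegral_expMajorant_sub_le z A]

lemma log_le_neg_log_add_mul {a u : ℝ} (ha : 0 < a) (hu : 0 < u) :
    Real.log u ≤ -Real.log a + a * u := by
  have := Real.log_le_sub_one_of_pos (mul_pos ha hu)
  rw [Real.log_mul ha.ne' hu.ne'] at this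
  linarith

lemma setLIntegral_abs_Kker_le_log (z : Strip) (A : Set Strip) {a : ℝ} (ha : 0 < a)
    (ha1 : a ≤ 1) :
    ∫⁻ ξ in A, ENNReal.ofReal |Kker z ξ|
      ≤ ENNReal.ofReal (4 * (|Real.log a| + a)) * volume A
        + ENNReal.ofReal (4 * a) * ∫⁻ ξ : Strip, ENNReal.ofReal (expMajorant ξ.1) := by
  calc ∫⁻ ξ in A, ENNReal.ofReal |Kker z ξ|
      ≤ ∫⁻ ξ in A, (ENNReal.ofReal (4 * (|Real.log a| + a))
          + ENNReal.ofReal (4 * a) * ENNReal.ofReal (expMajorant (z.1 - ξ.1))) := by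
        refine lintegral_mono_ae ((ae_restrict_of_ae (ae_abs_Kker_le z)).mono fun ξ hξ => ?_)
        have h0 := expMajorant_nonneg (z.1 - ξ.1)
        rw [← ENNReal.ofReal_mul (by positivity), ← ENNReal.ofReal_add (by positivity)
          (by positivity)]
        refine ENNReal.ofReal_le_ofReal (hξ.trans ?_)
        have := log_le_neg_log_add_mul ha (u := 1 + expMajorant (z.1 - ξ.1)) (by linarith)
        rw [abs_of_nonpos (Real.log_nonpos ha.le ha1)]
        linarith
    _ = ENNReal.ofReal (4 * (|Real.log a| + a)) * volume A
        + ENNReal.ofReal (4 * a) * ∫⁻ ξ in A, ENNReal.ofReal (expMajorant (z.1 - ξ.1)) := by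
        rw [lintegral_add_left measurable_const, setLIntegral_const,
          lintegral_const_mul' _ _ ENNReal.ofReal_ne_top]
    _ ≤ _ := by grw [setLIntegral_expMajorant_sub_le z A]

/-- There is an absolute constant `C > 0` such that for every measurable
`A ⊆ S` of finite measure: (i) `∫_A∫_A |K| ≤ C·|A|`; and (ii) if moreover `0 < |A| < 1/2`,
then `∫_A∫_A |K| ≤ C·|A|²·(1 + |log|A||)`. -/
theorem stmt_19 :
    ∃ C > (0 : ℝ), ∀ A : Set Strip, MeasurableSet A → volume A < ⊤ →
      (∫⁻ z in A, ∫⁻ ξ in A, ENNReal.ofReal |Kker z ξ| ≤ ENNReal.ofReal C * volume A) ∧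
      (0 < volume A → volume A < ENNReal.ofReal (1 / 2) →
        ∫⁻ z in A, ∫⁻ ξ in A, ENNReal.ofReal |Kker z ξ| ≤
          ENNReal.ofReal (C * (volume A).toReal ^ 2 *
            (1 + |Real.log (volume A).toReal|))) := by
  obtain ⟨J, hJ0, hJ⟩ : ∃ J : ℝ, 0 ≤ J ∧
      ∫⁻ ξ : Strip, ENNReal.ofReal (expMajorant ξ.1) = ENNReal.ofReal J :=
    ⟨_, ENNReal.toReal_nonneg, (ENNReal.ofReal_toReal lintegral_strip_expMajorant_lt_top.ne).symm⟩
  refine ⟨4 * (1 + J), by positivity, fun A _ hfin => ⟨?_, fun hpos hlt => ?_⟩⟩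
  · calc ∫⁻ z in A, ∫⁻ ξ in A, ENNReal.ofReal |Kker z ξ|
        ≤ ∫⁻ _ in A, ENNReal.ofReal (4 * (1 + J)) := by
          refine lintegral_mono fun z => (setLIntegral_abs_Kker_le z A).trans ?_
          rw [hJ, ← ENNReal.ofReal_ofNat 4, ← ENNReal.ofReal_mul (by norm_num)]
          exact ENNReal.ofReal_le_ofReal (by linarith)
      _ = _ := setLIntegral_const _ _
  · obtain ⟨a, ha, haA⟩ : ∃ a : ℝ, 0 < a ∧ volume A = ENNReal.ofReal a :=
      ⟨_, ENNReal.toReal_pos hpos.ne' hfin.ne, (ENNReal.ofReal_toReal hfin.ne).symm⟩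
    have ha1 : a ≤ 1 := by
      rw [haA, ENNReal.ofReal_lt_ofReal_iff (by norm_num)] at hlt
      linarith
    rw [haA, ENNReal.toReal_ofReal ha.le]
    calc ∫⁻ z in A, ∫⁻ ξ in A, ENNReal.ofReal |Kker z ξ|
        ≤ ∫⁻ _ in A, ENNReal.ofReal (4 * (|Real.log a| + a) * a + 4 * a * J) := by
          refine lintegral_mono fun z => (setLIntegral_abs_Kker_le_log z A ha ha1).trans_eq ?_
          rw [hJ, haA, ← ENNReal.ofReal_mul (by positivity), ← ENNReal.ofReal_mul (by positivity),
            ← ENNReal.ofReal_add (by positivity) (by positivity)]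
      _ = ENNReal.ofReal ((4 * (|Real.log a| + a) * a + 4 * a * J) * a) := by
          rw [setLIntegral_const, haA, ← ENNReal.ofReal_mul (by positivity)]
      _ ≤ _ := by
          refine ENNReal.ofReal_le_ofReal ?_
          have hl := abs_nonneg (Real.log a)
          have h : |Real.log a| + a + J ≤ (1 + J) * (1 + |Real.log a|) := by nlinarith
          have := mul_le_mul_of_nonneg_left h (by positivity : 0 ≤ 4 * a ^ 2)
          linarith
end
end
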